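/- arXiv:2307.03527 — 3 statements merged into one kernel-verified Lean document; each statement's English description precedes it below -/
import Mathlib

section
/- Let n ≥ 2 be an integer and p ∈ (1,n) a real number. For every smooth compactly supported function f : ℝ^n → ℝ one has (∫_{ℝ^n} |f|^{p*} dx)^{1/p*} ≤ AT(n,p) · (∫_{ℝ^n} |∇f|^p dx)^{1/p}. -/
open Real MeasureTheory Filter Topology

/-- The volume of the unit ball in `ℝ^n`: `ω_n = π^(n/2) / Γ(n/2 + 1)`. -/
noncomputable def ballVol (n : ℕ) : ℝ := Real.pi ^ ((n : ℝ) / 2) / Real.Gamma ((n : ℝ) / 2 + 1)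

/-- The Aubin–Talenti constant `AT(n,p)`. -/
noncomputable def AT (n : ℕ) (p : ℝ) : ℝ :=
  Real.pi ^ (-(1 : ℝ) / 2) * (n : ℝ) ^ (-(1 / p)) *
    ((p - 1) / ((n : ℝ) - p)) ^ (1 / (p / (p - 1))) *
    (Real.Gamma (1 + (n : ℝ) / 2) * Real.Gamma (n : ℝ) /
      (Real.Gamma ((n : ℝ) / p) * Real.Gamma (1 + (n : ℝ) / (p / (p - 1))))) ^ (1 / (n : ℝ))

/-- One-dimensional monotone transport between two families of positive densities depending
continuously on a parameter. -/
theorem exists_monotone_transport {X : Type*} [TopologicalSpace X]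
    (R L : ℝ) (a b : X → ℝ → ℝ)
    (ha : Continuous (Function.uncurry a)) (hb : Continuous (Function.uncurry b))
    (hbpos : ∀ x, ∃ δ > 0, ∀ s, δ ≤ b x s)
    (hab : ∀ x, ∫ t in (-R)..R, a x t = ∫ s in (-L)..L, b x s) :
    ∃ τ : X → ℝ → ℝ, Continuous (Function.uncurry τ) ∧
      (∀ x t, HasDerivAt (τ x) (a x t / b x (τ x t)) t) ∧
      (∀ x, τ x (-R) = -L) ∧ ∀ x, τ x R = L := by
  have hax : ∀ x, Continuous (a x) := fun x => ha.comp (Continuous.prodMk_right x)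
  have hbx : ∀ x, Continuous (b x) := fun x => hb.comp (Continuous.prodMk_right x)
  have hb0 : ∀ x s, 0 < b x s := fun x s => by
    obtain ⟨δ, hδ, h⟩ := hbpos x
    exact hδ.trans_le (h s)
  set A : X → ℝ → ℝ := fun x t => ∫ r in (-R)..t, a x r with hA
  set B : X → ℝ → ℝ := fun x s => ∫ r in (-L)..s, b x r with hB
  have hAd : ∀ x t, HasDerivAt (A x) (a x t) t := fun x t =>
    ((hax x).integral_hasStrictDerivAt (-R) t).hasDerivAt
  have hBd : ∀ x t, HasDerivAt (B x) (b x t) t := fun x t =>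
    ((hbx x).integral_hasStrictDerivAt (-L) t).hasDerivAt
  have hAc : Continuous (fun z : X × ℝ => A z.1 z.2) :=
    intervalIntegral.continuous_parametric_intervalIntegral_of_continuous
      (f := fun z : X × ℝ => a z.1)
      (ha.comp (by fun_prop : Continuous fun w : (X × ℝ) × ℝ => (w.1.1, w.2))) continuous_snd
  have hBc : Continuous (fun z : X × ℝ => B z.1 z.2) :=
    intervalIntegral.continuous_parametric_intervalIntegral_of_continuous
      (f := fun z : X × ℝ => b z.1)
      (hb.comp (by fun_prop : Continuous fun w : (X × ℝ) × ℝ => (w.1.1, w.2))) continuous_snd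
  have hBm : ∀ x, StrictMono (B x) := fun x =>
    strictMono_of_hasDerivAt_pos (hBd x) (hb0 x)
  have hBxc : ∀ x, Continuous (B x) := fun x => hBc.comp (Continuous.prodMk_right x)
  have hBs : ∀ x, Function.Surjective (B x) := by
    intro x
    obtain ⟨δ, hδ, h⟩ := hbpos x
    have hmono : Monotone fun s => B x s - δ * s :=
      monotone_of_hasDerivAt_nonneg (fun s => (hBd x s).sub ((hasDerivAt_id s).const_mul δ))
        (fun s => by simpa using h s)
    refine (hBxc x).surjective ?_ ?_
    · refine tendsto_atTop_mono' atTop (f₁ := fun s => δ * s + (B x 0 - δ * 0)) ?_ ?_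
      · filter_upwards [eventually_ge_atTop 0] with s hs
        have := hmono hs
        simp only at this
        linarith
      · exact tendsto_atTop_add_const_right _ _ (tendsto_id.const_mul_atTop hδ)
    · refine tendsto_atBot_mono' atBot (f₁ := fun s => δ * s + (B x 0 - δ * 0)) ?_ ?_
      · filter_upwards [eventually_le_atBot 0] with s hs
        have := hmono hs
        simp only at this
        linarith
      · exact tendsto_atBot_add_const_right _ _ (tendsto_id.const_mul_atBot hδ)
  choose τ hτ using fun (x : X) (t : ℝ) => hBs x (A x t)
  have hτc : Continuous (Function.uncurry τ) := by
    rw [continuous_iff_continuousAt]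
    intro z
    rw [ContinuousAt, tendsto_order]
    constructor
    · intro s hs
      have h1 : B z.1 s < A z.1 z.2 := by rw [← hτ]; exact hBm _ hs
      have h2 : ∀ᶠ w : X × ℝ in 𝓝 z, B w.1 s < A w.1 w.2 :=
        ((hBc.comp (by fun_prop : Continuous fun w : X × ℝ => (w.1, s))).tendsto z).eventually_lt
          (hAc.tendsto z) h1
      filter_upwards [h2] with w hw
      rw [← hτ] at hw
      exact (hBm _).lt_iff_lt.1 hw
    · intro s hs
      have h1 : A z.1 z.2 < B z.1 s := by rw [← hτ]; exact hBm _ hs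
      have h2 : ∀ᶠ w : X × ℝ in 𝓝 z, A w.1 w.2 < B w.1 s :=
        (hAc.tendsto z).eventually_lt
          ((hBc.comp (by fun_prop : Continuous fun w : X × ℝ => (w.1, s))).tendsto z) h1
      filter_upwards [h2] with w hw
      rw [← hτ] at hw
      exact (hBm _).lt_iff_lt.1 hw
  refine ⟨τ, hτc, fun x t => ?_, fun x => ?_, fun x => ?_⟩
  · let e : ℝ ≃o ℝ := (hBm x).orderIsoOfSurjective (B x) (hBs x)
    have he : ∀ s, e s = B x s := fun s => rfl
    have h1 : HasDerivAt e.symm (b x (τ x t))⁻¹ (A x t) := by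
      refine HasDerivAt.of_local_left_inverse (f := B x) e.symm.continuous.continuousAt ?_
        (hb0 _ _).ne' (Eventually.of_forall fun y => ?_)
      · have : e.symm (A x t) = τ x t := by
          rw [OrderIso.symm_apply_eq, he, hτ]
        rw [this]
        exact hBd _ _
      · rw [← he, OrderIso.apply_symm_apply]
    have h2 := h1.comp t (hAd x t)
    have h3 : τ x = e.symm ∘ A x := by
      funext r
      rw [Function.comp_apply, OrderIso.eq_symm_apply, he, hτ]
    rw [← h3] at h2
    rw [div_eq_inv_mul]
    exact h2
  · apply (hBm x).injective
    rw [hτ]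
    simp [hA, hB]
  · apply (hBm x).injective
    rw [hτ]
    exact hab x

/-- Lebesgue measure restricted to the cube `(-R, R]^n`. -/
noncomputable def cubeMeasure (n : ℕ) (R : ℝ) : Measure (Fin n → ℝ) :=
  Measure.pi fun _ => volume.restrict (Set.Ioc (-R) R)

instance (n : ℕ) (R : ℝ) : IsFiniteMeasure (cubeMeasure n R) := by
  unfold cubeMeasure; infer_instance

theorem cubeMeasure_eq_restrict (n : ℕ) (R : ℝ) :
    cubeMeasure n R = volume.restrict (Set.univ.pi fun _ : Fin n => Set.Ioc (-R) R) := by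
  rw [cubeMeasure, volume_pi, Measure.restrict_pi_pi]

theorem ae_cubeMeasure_mem (n : ℕ) (R : ℝ) :
    ∀ᵐ x ∂cubeMeasure n R, ∀ i, x i ∈ Set.Ioc (-R) R := by
  rw [cubeMeasure_eq_restrict]
  filter_upwards [ae_restrict_mem (MeasurableSet.univ_pi fun _ => measurableSet_Ioc)] with x hx i
  exact hx i trivial

theorem Continuous.integrable_cubeMeasure {n : ℕ} {R : ℝ} {f : (Fin n → ℝ) → ℝ}
    (hf : Continuous f) : Integrable f (cubeMeasure n R) := by
  rw [cubeMeasure_eq_restrict]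
  refine (hf.continuousOn.integrableOn_compact
    (isCompact_univ_pi fun _ : Fin n => isCompact_Icc (a := -R) (b := R))).mono_set ?_
  exact Set.pi_mono fun _ _ => Set.Ioc_subset_Icc_self

theorem integral_cubeMeasure_insertNth {n : ℕ} {R : ℝ} (hR : 0 ≤ R) (i : Fin (n + 1))
    {f : (Fin (n + 1) → ℝ) → ℝ} (hf : Continuous f) :
    ∫ x, f x ∂cubeMeasure (n + 1) R =
      ∫ y, (∫ t in (-R)..R, f (i.insertNth t y)) ∂cubeMeasure n R := by
  have h := measurePreserving_piFinSuccAbove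
    (fun _ : Fin (n + 1) => (volume.restrict (Set.Ioc (-R) R) : Measure ℝ)) i
  have hint : Integrable f (cubeMeasure (n + 1) R) := hf.integrable_cubeMeasure
  have h' := h.symm
  rw [cubeMeasure, ← h'.integral_comp (MeasurableEquiv.measurableEmbedding _), integral_prod_symm]
  · refine integral_congr_ae (Eventually.of_forall fun y => ?_)
    simp only
    rw [intervalIntegral.integral_of_le (by linarith)]
    rfl
  · exact (h'.integrable_comp_emb (MeasurableEquiv.measurableEmbedding _)).2 hint

theorem integral_cubeMeasure_cons {n : ℕ} {R : ℝ} (hR : 0 ≤ R)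
    {f : (Fin (n + 1) → ℝ) → ℝ} (hf : Continuous f) :
    ∫ x, f x ∂cubeMeasure (n + 1) R =
      ∫ y, (∫ t in (-R)..R, f (Fin.cons t y)) ∂cubeMeasure n R := by
  simp_rw [integral_cubeMeasure_insertNth hR 0 hf, Fin.insertNth_zero']

theorem Continuous.uncurry_cons {n : ℕ} {f : (Fin (n + 1) → ℝ) → ℝ} (hf : Continuous f) :
    Continuous (Function.uncurry fun (y : Fin n → ℝ) (t : ℝ) => f (Fin.cons t y)) :=
  hf.comp (Continuous.finCons (A := fun _ => ℝ) continuous_snd continuous_fst)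

theorem Continuous.integral_cons {n : ℕ} (R : ℝ) {f : (Fin (n + 1) → ℝ) → ℝ}
    (hf : Continuous f) :
    Continuous fun y : Fin n → ℝ => ∫ t in (-R)..R, f (Fin.cons t y) :=
  intervalIntegral.continuous_parametric_intervalIntegral_of_continuous' hf.uncurry_cons _ _

theorem le_integral_cons {n : ℕ} {R δ : ℝ} (hR : 0 ≤ R) {f : (Fin (n + 1) → ℝ) → ℝ}
    (hf : Continuous f) (hδ : ∀ x, δ ≤ f x) (y : Fin n → ℝ) :
    2 * R * δ ≤ ∫ t in (-R)..R, f (Fin.cons t y) := by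
  have h := intervalIntegral.integral_mono_on (a := -R) (b := R) (by linarith)
    (continuous_const.intervalIntegrable (-R) R : IntervalIntegrable (fun _ => δ) volume (-R) R)
    ((hf.uncurry_cons.comp (Continuous.prodMk_right y)).intervalIntegrable _ _)
    (fun t _ => hδ (Fin.cons t y))
  simp only [intervalIntegral.integral_const, smul_eq_mul] at h
  exact le_trans (by linarith) h

/-- The Knothe map between two positive continuous densities on cubes. `D x i` is the `i`-th
diagonal entry of its (triangular) Jacobian. -/
theorem exists_knothe_map (n : ℕ) {R L : ℝ} (hR : 0 < R) (hL : 0 < L)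
    (u v : (Fin n → ℝ) → ℝ) (hu : Continuous u) (hv : Continuous v)
    {δ : ℝ} (hδ : 0 < δ) (hδu : ∀ x, δ ≤ u x) (hδv : ∀ y, δ ≤ v y)
    (huv : ∫ x, u x ∂cubeMeasure n R = ∫ y, v y ∂cubeMeasure n L) :
    ∃ T D : (Fin n → ℝ) → Fin n → ℝ, Continuous T ∧ Continuous D ∧ (∀ x i, 0 ≤ D x i) ∧
      (∀ x, (∏ i, D x i) * v (T x) = u x) ∧
      (∀ x, (∀ i, x i ∈ Set.Icc (-R) R) → ∀ i, T x i ∈ Set.Icc (-L) L) ∧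
      (∀ x i t, HasDerivAt (fun s => T (Function.update x i s) i)
        (D (Function.update x i t) i) t) ∧
      ∀ h : (Fin n → ℝ) → ℝ, Continuous h →
        ∫ x, h (T x) * u x ∂cubeMeasure n R = ∫ y, h y * v y ∂cubeMeasure n L := by
  induction n generalizing δ with
  | zero =>
    refine ⟨id, id, continuous_id, continuous_id, fun _ i => i.elim0, fun x => ?_,
      fun _ _ i => i.elim0, fun _ i => i.elim0, fun h _ => ?_⟩
    · simp only [cubeMeasure, Measure.pi_of_empty _ (0 : Fin 0 → ℝ), integral_dirac] at huv
      rw [Subsingleton.elim x 0, Subsingleton.elim (id 0) 0, huv]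
      simp
    · simp only [cubeMeasure, Measure.pi_of_empty _ (0 : Fin 0 → ℝ), integral_dirac] at huv ⊢
      rw [id, huv]
  | succ n ih =>
    set U : (Fin n → ℝ) → ℝ := fun y => ∫ t in (-R)..R, u (Fin.cons t y) with hU
    set V : (Fin n → ℝ) → ℝ := fun y => ∫ t in (-L)..L, v (Fin.cons t y) with hV
    have hUc : Continuous U := hu.integral_cons R
    have hVc : Continuous V := hv.integral_cons L
    have hδ' : 0 < min (2 * R * δ) (2 * L * δ) := by positivity
    have hUδ : ∀ y, min (2 * R * δ) (2 * L * δ) ≤ U y := fun y =>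
      (min_le_left _ _).trans (le_integral_cons hR.le hu hδu y)
    have hVδ : ∀ y, min (2 * R * δ) (2 * L * δ) ≤ V y := fun y =>
      (min_le_right _ _).trans (le_integral_cons hL.le hv hδv y)
    have hU0 : ∀ y, 0 < U y := fun y => hδ'.trans_le (hUδ y)
    have hV0 : ∀ y, 0 < V y := fun y => hδ'.trans_le (hVδ y)
    have hu0 : ∀ y, 0 < u y := fun y => hδ.trans_le (hδu y)
    have hv0 : ∀ y, 0 < v y := fun y => hδ.trans_le (hδv y)
    obtain ⟨S, E, hSc, hEc, hE0, hSE, hScube, hSd, hSpush⟩ := ih U V hUc hVc hδ' hUδ hVδ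
      (by rw [← integral_cubeMeasure_cons hR.le hu, ← integral_cubeMeasure_cons hL.le hv, huv])
    obtain ⟨τ, hτc, hτd, hτR, hτL⟩ := exists_monotone_transport R L
      (fun (y : Fin n → ℝ) t => u (Fin.cons t y) / U y)
      (fun y s => v (Fin.cons s (S y)) / V (S y))
      (hu.uncurry_cons.div (hUc.comp continuous_fst) fun z => (hU0 _).ne')
      ((hv.uncurry_cons.comp ((hSc.comp continuous_fst).prodMk continuous_snd)).div
        (hVc.comp (hSc.comp continuous_fst)) fun z => (hV0 _).ne')
      (fun y => ⟨δ / V (S y), div_pos hδ (hV0 _), fun s =>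
        div_le_div_of_nonneg_right (hδv _) (hV0 _).le⟩)
      (fun y => by
        rw [intervalIntegral.integral_div, intervalIntegral.integral_div]
        change U y / U y = V (S y) / V (S y)
        rw [div_self (hU0 _).ne', div_self (hV0 _).ne'])
    set d : (Fin n → ℝ) → ℝ → ℝ := fun y t =>
      u (Fin.cons t y) / U y / (v (Fin.cons (τ y t) (S y)) / V (S y)) with hd
    have hd0 : ∀ y t, 0 ≤ d y t := fun y t =>
      (div_pos (div_pos (hu0 _) (hU0 _)) (div_pos (hv0 _) (hV0 _))).le
    have hdc : Continuous (Function.uncurry d) :=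
      (hu.uncurry_cons.div (hUc.comp continuous_fst) fun z => (hU0 _).ne').div
        ((hv.uncurry_cons.comp ((hSc.comp continuous_fst).prodMk hτc)).div
          (hVc.comp (hSc.comp continuous_fst)) fun z => (hV0 _).ne')
        fun z => (div_pos (hv0 _) (hV0 _)).ne'
    have htail : Continuous fun x : Fin (n + 1) → ℝ => (Fin.tail x : Fin n → ℝ) :=
      Continuous.finTail (A := fun _ => ℝ) continuous_id
    have hsplit : Continuous fun x : Fin (n + 1) → ℝ => ((Fin.tail x : Fin n → ℝ), x 0) :=
      htail.prodMk (continuous_apply 0)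
    have hτm : ∀ y, Monotone (τ y) := fun y =>
      monotone_of_hasDerivAt_nonneg (hτd y) (hd0 y)
    refine ⟨fun x => Fin.cons (τ (Fin.tail x) (x 0)) (S (Fin.tail x)),
      fun x => Fin.cons (d (Fin.tail x) (x 0)) (E (Fin.tail x)),
      Continuous.finCons (A := fun _ => ℝ) (hτc.comp hsplit) (hSc.comp htail),
      Continuous.finCons (A := fun _ => ℝ) (hdc.comp hsplit) (hEc.comp htail),
      fun x i => ?_, fun x => ?_, fun x hx i => ?_, fun x i t => ?_, fun h hh => ?_⟩
    · refine Fin.cases ?_ (fun j => ?_) i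
      · exact hd0 _ _
      · exact hE0 _ _
    · rw [Fin.prod_univ_succ]
      simp only [Fin.cons_zero, Fin.cons_succ]
      have h1 := hSE (Fin.tail x)
      have h2 := (hv0 (Fin.cons (τ (Fin.tail x) (x 0)) (S (Fin.tail x)))).ne'
      have h3 := (hV0 (S (Fin.tail x))).ne'
      have h4 := (hU0 (Fin.tail x)).ne'
      simp only [hd, Fin.cons_self_tail]
      field_simp
      rw [← h1]
      ring
    · refine Fin.cases ?_ (fun j => ?_) i
      · simp only [Fin.cons_zero]
        exact ⟨(hτR _).symm.trans_le (hτm _ (hx 0).1), (hτm _ (hx 0).2).trans_eq (hτL _)⟩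
      · simp only [Fin.cons_succ]
        exact hScube _ (fun k => hx k.succ) j
    · refine Fin.cases ?_ (fun j => ?_) i
      · simp only [Fin.cons_zero, Fin.tail_update_zero, Function.update_self]
        exact hτd _ _
      · simp only [Fin.cons_succ, Fin.tail_update_succ]
        exact hSd _ _ _
    · have hTc : Continuous fun x : Fin (n + 1) → ℝ =>
          (Fin.cons (τ (Fin.tail x) (x 0)) (S (Fin.tail x)) : Fin (n + 1) → ℝ) :=
        Continuous.finCons (A := fun _ => ℝ) (hτc.comp hsplit) (hSc.comp htail)
      have hhv : Continuous fun y => h y * v y := hh.mul hv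
      have hhu : Continuous fun x : Fin (n + 1) → ℝ =>
          h (Fin.cons (τ (Fin.tail x) (x 0)) (S (Fin.tail x))) * u x := (hh.comp hTc).mul hu
      rw [integral_cubeMeasure_cons hR.le hhu,
        integral_cubeMeasure_cons hL.le hhv]
      set H : (Fin n → ℝ) → ℝ := fun y => (∫ s in (-L)..L, h (Fin.cons s y) * v (Fin.cons s y)) / V y
        with hH
      have hHc : Continuous H := (hhv.integral_cons L).div hVc fun y => (hV0 y).ne'
      have hHV : ∀ y, ∫ s in (-L)..L, h (Fin.cons s y) * v (Fin.cons s y) = H y * V y := fun y =>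
        (div_mul_cancel₀ _ (hV0 y).ne').symm
      simp_rw [hHV]
      rw [← hSpush H hHc]
      refine integral_congr_ae (Eventually.of_forall fun y => ?_)
      simp only [Fin.cons_zero, Fin.tail_cons]
      have hsub := intervalIntegral.integral_comp_mul_deriv (a := -R) (b := R) (f := τ y)
        (f' := d y) (g := fun s => h (Fin.cons s (S y)) * v (Fin.cons s (S y)))
        (fun t _ => hτd y t) (hdc.comp (Continuous.prodMk_right y)).continuousOn
        (hhv.uncurry_cons.comp (Continuous.prodMk_right (S y)))
      rw [hτR, hτL, hHV] at hsub
      have h3 := (hV0 (S y)).ne'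
      have h4 := (hU0 y).ne'
      have : H (S y) * U y = U y / V (S y) * (H (S y) * V (S y)) := by field_simp
      rw [this, ← hsub, ← intervalIntegral.integral_const_mul]
      refine intervalIntegral.integral_congr fun t _ => ?_
      have h2 := (hv0 (Fin.cons (τ y t) (S y))).ne'
      simp only [hd, Function.comp]
      field_simp

theorem integral_mul_le_sub_of_hasDerivAt_update {n : ℕ} {R L η : ℝ} (hR : 0 ≤ R) (hη : 0 ≤ η)
    {ψ : (Fin (n + 1) → ℝ) → ℝ} {ψ' : (Fin (n + 1) → ℝ) → (Fin (n + 1) → ℝ) →L[ℝ] ℝ}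
    (hψ : ∀ x, HasFDerivAt ψ (ψ' x) x) (hψ' : Continuous ψ') (i : Fin (n + 1))
    (hface : ∀ x, |x i| = R → ψ x = η)
    {T D : (Fin (n + 1) → ℝ) → ℝ} (hT : Continuous T) (hD : Continuous D)
    (hcube : ∀ x, (∀ i, x i ∈ Set.Icc (-R) R) → T x ∈ Set.Icc (-L) L)
    (hder : ∀ x t, HasDerivAt (fun s => T (Function.update x i s)) (D (Function.update x i t)) t) :
    ∫ x, ψ x * D x ∂cubeMeasure (n + 1) R ≤
      (cubeMeasure n R).real Set.univ * (2 * L * η) -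
        ∫ x, ψ' x (Pi.single i 1) * T x ∂cubeMeasure (n + 1) R := by
  have hψc : Continuous ψ := continuous_iff_continuousAt.2 fun x => (hψ x).continuousAt
  have hψ'c : Continuous fun x => ψ' x (Pi.single i 1) := hψ'.clm_apply continuous_const
  have hins : Continuous fun z : (Fin n → ℝ) × ℝ => (i.insertNth z.2 z.1 : Fin (n + 1) → ℝ) :=
    Continuous.finInsertNth (A := fun _ => ℝ) i continuous_snd continuous_fst
  have hins' : ∀ y : Fin n → ℝ, Continuous fun t : ℝ => (i.insertNth t y : Fin (n + 1) → ℝ) :=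
    fun y => hins.comp (Continuous.prodMk_right y)
  have h1c : Continuous fun x => ψ x * D x := hψc.mul hD
  have h2c : Continuous fun x => ψ' x (Pi.single i 1) * T x := hψ'c.mul hT
  have hslice : ∀ {F : (Fin (n + 1) → ℝ) → ℝ}, Continuous F → Integrable
      (fun y : Fin n → ℝ => ∫ t in (-R)..R, F (i.insertNth t y)) (cubeMeasure n R) := fun {F} hF =>
    Continuous.integrable_cubeMeasure <|
      intervalIntegral.continuous_parametric_intervalIntegral_of_continuous'
        (f := fun (y : Fin n → ℝ) t => F (i.insertNth t y)) (hF.comp hins) _ _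
  rw [integral_cubeMeasure_insertNth hR i h1c,
    integral_cubeMeasure_insertNth hR i h2c,
    ← smul_eq_mul (a := (cubeMeasure n R).real Set.univ), ← integral_const, ← integral_sub
      (integrable_const _) (hslice h2c)]
  refine integral_mono_ae (hslice h1c) ((integrable_const _).sub
    (hslice h2c)) ?_
  filter_upwards [ae_cubeMeasure_mem n R] with y hy
  have hT1 : ∀ t, HasDerivAt (fun s => T (i.insertNth s y)) (D (i.insertNth t y)) t := fun t => by
    simpa only [Fin.update_insertNth] using hder (i.insertNth t y) t
  have hψ1 : ∀ t, HasDerivAt (fun s => ψ (i.insertNth s y))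
      (ψ' (i.insertNth t y) (Pi.single i 1)) t := fun t => by
    have h1 := hasDerivAt_update (𝕜 := ℝ) (i.insertNth t y : Fin (n + 1) → ℝ) i t
    have h2 := (hψ (Function.update (i.insertNth t y : Fin (n + 1) → ℝ) i t)).comp_hasDerivAt t h1
    simpa only [Function.comp_def, Fin.update_insertNth] using h2
  rw [intervalIntegral.integral_mul_deriv_eq_deriv_mul (fun t _ => hψ1 t) (fun t _ => hT1 t)
    ((hψ'c.comp (hins' y)).intervalIntegrable _ _) ((hD.comp (hins' y)).intervalIntegrable _ _)]
  have hmem : ∀ t ∈ Set.Icc (-R) R, T (i.insertNth t y) ∈ Set.Icc (-L) L := fun t ht => by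
    refine hcube _ fun j => ?_
    refine Fin.succAboveCases i ?_ (fun k => ?_) j
    · simpa using ht
    · simpa using Set.Ioc_subset_Icc_self (hy k)
  rw [hface _ (by simp [abs_of_nonneg hR]), hface _ (by simp [abs_of_nonneg hR])]
  have h1 := hmem R ⟨by linarith, le_rfl⟩
  have h2 := hmem (-R) ⟨le_rfl, by linarith⟩
  have h3 : η * T (i.insertNth R y) ≤ η * L := mul_le_mul_of_nonneg_left h1.2 hη
  have h4 : η * -L ≤ η * T (i.insertNth (-R) y) := mul_le_mul_of_nonneg_left h2.1 hη
  linarith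

theorem integral_mul_sum_le {n : ℕ} {R L η : ℝ} (hR : 0 ≤ R) (hη : 0 ≤ η)
    {ψ : (Fin (n + 1) → ℝ) → ℝ} {ψ' : (Fin (n + 1) → ℝ) → (Fin (n + 1) → ℝ) →L[ℝ] ℝ}
    (hψ : ∀ x, HasFDerivAt ψ (ψ' x) x) (hψ' : Continuous ψ')
    (hface : ∀ x i, |x i| = R → ψ x = η)
    {T D : (Fin (n + 1) → ℝ) → Fin (n + 1) → ℝ} (hT : Continuous T) (hD : Continuous D)
    (hcube : ∀ x, (∀ i, x i ∈ Set.Icc (-R) R) → ∀ i, T x i ∈ Set.Icc (-L) L)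
    (hder : ∀ x i t, HasDerivAt (fun s => T (Function.update x i s) i)
        (D (Function.update x i t) i) t) :
    ∫ x, ψ x * ∑ i, D x i ∂cubeMeasure (n + 1) R ≤
      (n + 1) * ((cubeMeasure n R).real Set.univ * (2 * L * η)) +
        ∫ x, |ψ' x (T x)| ∂cubeMeasure (n + 1) R := by
  have hψc : Continuous ψ := continuous_iff_continuousAt.2 fun x => (hψ x).continuousAt
  have hTi : ∀ i, Continuous fun x => T x i := fun i => (continuous_apply i).comp hT
  have hDi : ∀ i, Continuous fun x => D x i := fun i => (continuous_apply i).comp hD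
  have hψ'i : ∀ i, Continuous fun x => ψ' x (Pi.single i 1) * T x i := fun i =>
    (hψ'.clm_apply continuous_const).mul (hTi i)
  have hψD : ∀ i, Continuous fun x => ψ x * D x i := fun i => hψc.mul (hDi i)
  have hsum : ∀ x, ψ' x (T x) = ∑ i, ψ' x (Pi.single i 1) * T x i := fun x => by
    conv_lhs => rw [← Finset.univ_sum_single (T x), map_sum]
    refine Finset.sum_congr rfl fun i _ => ?_
    have : Pi.single i (T x i) = T x i • (Pi.single i 1 : Fin (n + 1) → ℝ) := by
      rw [← Pi.single_smul, smul_eq_mul, mul_one]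
    rw [this, map_smul, smul_eq_mul, mul_comm]
  simp_rw [Finset.mul_sum]
  rw [integral_finsetSum _ fun i _ => (hψD i).integrable_cubeMeasure]
  have h1 := Finset.sum_le_sum fun i (_ : i ∈ Finset.univ) =>
    integral_mul_le_sub_of_hasDerivAt_update (L := L) hR hη hψ hψ' i (fun x => hface x i) (hTi i)
      (hDi i) (fun x hx => hcube x hx i) (fun x t => hder x i t)
  refine h1.trans ?_
  rw [Finset.sum_sub_distrib, ← integral_finsetSum _ fun i _ => (hψ'i i).integrable_cubeMeasure]
  simp_rw [← hsum]
  rw [Finset.sum_const, Finset.card_univ, Fintype.card_fin, nsmul_eq_mul, sub_eq_add_neg]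
  push_cast
  refine add_le_add le_rfl ?_
  exact (neg_le_abs _).trans abs_integral_le_integral_abs

theorem Continuous.memLp_cubeMeasure {n : ℕ} {R : ℝ} {f : (Fin n → ℝ) → ℝ} (hf : Continuous f)
    (p : ENNReal) : MemLp f p (cubeMeasure n R) := by
  obtain ⟨C, hC⟩ := (isCompact_univ_pi fun _ : Fin n => isCompact_Icc (a := -R) (b := R)).exists_bound_of_continuousOn
    hf.continuousOn
  refine MemLp.of_bound hf.aestronglyMeasurable C ?_
  filter_upwards [ae_cubeMeasure_mem n R] with x hx
  exact hC x fun i _ => Set.Ioc_subset_Icc_self (hx i)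

theorem integral_cubeMeasure_pos {n : ℕ} {R : ℝ} (hR : 0 < R) {f : (Fin n → ℝ) → ℝ}
    (hf : Continuous f) (hpos : ∀ x, 0 < f x) : 0 < ∫ x, f x ∂cubeMeasure n R := by
  rw [integral_pos_iff_support_of_nonneg (fun x => (hpos x).le) hf.integrable_cubeMeasure]
  have : Function.support f = Set.univ := Set.eq_univ_of_forall fun x => (hpos x).ne'
  rw [this, cubeMeasure, Measure.pi_univ]
  refine pos_iff_ne_zero.2 (Finset.prod_ne_zero_iff.2 fun i _ => ?_)
  simp [hR]

/-- The Euclidean norm on `Fin n → ℝ`. -/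
noncomputable def euclNorm {n : ℕ} (x : Fin n → ℝ) : ℝ := ‖WithLp.toLp 2 x‖

theorem continuous_euclNorm {n : ℕ} : Continuous (euclNorm : (Fin n → ℝ) → ℝ) :=
  continuous_norm.comp (PiLp.continuous_toLp 2 _)

theorem euclNorm_nonneg {n : ℕ} (x : Fin n → ℝ) : 0 ≤ euclNorm x := norm_nonneg _

theorem rpow_integral_transport_le {n : ℕ} {p q α β : ℝ} (hpq : p.HolderConjugate q) (hα : 0 < α) (hβ : 0 ≤ β)
    (hαβ : α = β + α / (n + 1)) (hβq : (β - 1) * q = α)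
    {R L ε : ℝ} (hR : 0 < R) (hL : 0 < L) (hε : 0 < ε)
    {φ G : (Fin (n + 1) → ℝ) → ℝ} {φ' : (Fin (n + 1) → ℝ) → (Fin (n + 1) → ℝ) →L[ℝ] ℝ}
    (hφ : ∀ x, HasFDerivAt φ (φ' x) x) (hφ' : Continuous φ') (hφε : ∀ x, ε ≤ φ x)
    (hface : ∀ x i, |x i| = R → φ x = ε)
    (hG : Continuous G) (hG0 : ∀ x, 0 ≤ G x) (hφG : ∀ x y, |φ' x y| ≤ G x * euclNorm y)
    {c : ℝ} (hc : c * ∫ y, (1 + euclNorm y ^ q) ^ (-(n + 1 : ℝ)) ∂cubeMeasure (n + 1) L =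
      ∫ x, φ x ^ α ∂cubeMeasure (n + 1) R) :
    c * ∫ y, (1 + euclNorm y ^ q) ^ (-(n : ℝ)) ∂cubeMeasure (n + 1) L ≤
      c ^ (1 / (n + 1 : ℝ)) / (n + 1) *
        ((n + 1) * ((cubeMeasure n R).real Set.univ * (2 * L * ε ^ β)) +
          β * ((∫ x, G x ^ p ∂cubeMeasure (n + 1) R) ^ (1 / p) *
            (c * ∫ y, euclNorm y ^ q * (1 + euclNorm y ^ q) ^ (-(n + 1 : ℝ))
              ∂cubeMeasure (n + 1) L) ^ (1 / q))) := by
  have hq0 : 0 < q := hpq.symm.pos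
  have hφc : Continuous φ := continuous_iff_continuousAt.2 fun x => (hφ x).continuousAt
  have hφ0 : ∀ x, 0 < φ x := fun x => hε.trans_le (hφε x)
  set W : (Fin (n + 1) → ℝ) → ℝ := fun y => 1 + euclNorm y ^ q with hW
  have hWc : Continuous W :=
    continuous_const.add (continuous_euclNorm.rpow_const fun _ => Or.inr hq0.le)
  have hW0 : ∀ y, 0 < W y := fun y => by
    have := rpow_nonneg (euclNorm_nonneg y) q
    simp only [hW]; linarith
  have hrc : ∀ (F : (Fin (n + 1) → ℝ) → ℝ) (r : ℝ), Continuous F → (∀ y, 0 < F y) →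
    Continuous fun y => F y ^ r := fun F r hF hF0 => hF.rpow_const fun y => Or.inl (hF0 y).ne'
  have hWn := hrc W (-(n + 1 : ℝ)) hWc hW0
  have hc0 : 0 < c := by
    have h1 := integral_cubeMeasure_pos hL hWn fun y => rpow_pos_of_pos (hW0 y) _
    have h2 := integral_cubeMeasure_pos hR (hrc φ α hφc hφ0) fun y => rpow_pos_of_pos (hφ0 y) _
    rw [← hc] at h2
    exact (pos_iff_pos_of_mul_pos h2).2 h1
  obtain ⟨y₀, -, hy₀⟩ := (isCompact_univ_pi fun _ : Fin (n + 1) =>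
    isCompact_Icc (a := -L) (b := L)).exists_isMinOn
      ⟨0, fun _ _ => ⟨by simpa using hL.le, by simpa using hL.le⟩⟩ hWn.continuousOn
  set δ := W y₀ ^ (-(n + 1 : ℝ)) with hδ
  have hδ0 : 0 < δ := rpow_pos_of_pos (hW0 _) _
  set v : (Fin (n + 1) → ℝ) → ℝ := fun y => c * max (W y ^ (-(n + 1 : ℝ))) δ with hv
  have hvc : Continuous v := continuous_const.mul (hWn.max continuous_const)
  have hvW : ∀ y, (∀ i, y i ∈ Set.Icc (-L) L) → v y = c * W y ^ (-(n + 1 : ℝ)) := fun y hy => by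
    simp only [hv]
    rw [max_eq_left]
    exact hy₀ fun i _ => hy i
  have hvint : ∀ h : (Fin (n + 1) → ℝ) → ℝ, ∫ y, h y * v y ∂cubeMeasure (n + 1) L =
      c * ∫ y, h y * W y ^ (-(n + 1 : ℝ)) ∂cubeMeasure (n + 1) L := fun h => by
    rw [← integral_const_mul]
    refine integral_congr_ae ?_
    filter_upwards [ae_cubeMeasure_mem (n + 1) L] with y hy
    rw [hvW y fun i => Set.Ioc_subset_Icc_self (hy i)]
    ring
  obtain ⟨T, D, hTc, hDc, hD0, hTD, hTcube, hTd, hTpush⟩ := exists_knothe_map (n + 1) hR hL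
    (fun x => φ x ^ α) v (hrc φ α hφc hφ0) hvc (δ := min (ε ^ α) (c * δ)) (by positivity)
    (fun x => (min_le_left _ _).trans (rpow_le_rpow hε.le (hφε x) hα.le))
    (fun y => (min_le_right _ _).trans (mul_le_mul_of_nonneg_left (le_max_right _ _) hc0.le))
    (by
      rw [← hc]
      have := hvint fun _ => 1
      simpa using this.symm)
  have hN : (0 : ℝ) < n + 1 := by positivity
  have hTn : Continuous fun x => euclNorm (T x) := continuous_euclNorm.comp hTc
  have hWT : Continuous fun x => W (T x) := hWc.comp hTc
  have hDs : Continuous fun x => ∑ i, D x i :=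
    continuous_finsetSum _ fun i _ => (continuous_apply i).comp hDc
  have hpoint : ∀ᵐ x ∂cubeMeasure (n + 1) R, W (T x) * φ x ^ α ≤
      c ^ (1 / (n + 1 : ℝ)) / (n + 1) * (φ x ^ β * ∑ i, D x i) := by
    filter_upwards [ae_cubeMeasure_mem (n + 1) R] with x hx
    have h1 := hTD x
    rw [hvW _ (hTcube x fun i => Set.Ioc_subset_Icc_self (hx i))] at h1
    have hP0 : 0 ≤ ∏ i, D x i := Finset.prod_nonneg fun i _ => hD0 x i
    have h2 : φ x ^ α * W (T x) ^ (n + 1 : ℝ) = c * ∏ i, D x i := by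
      rw [← h1, rpow_neg (hW0 _).le]
      field_simp [(rpow_pos_of_pos (hW0 (T x)) (n + 1 : ℝ)).ne']
    have h3 : φ x ^ (α / (n + 1)) * W (T x) =
        c ^ (1 / (n + 1 : ℝ)) * (∏ i, D x i) ^ (1 / (n + 1 : ℝ)) := by
      rw [← mul_rpow hc0.le hP0, ← h2, mul_rpow (rpow_nonneg (hφ0 x).le _)
        (rpow_nonneg (hW0 _).le _), ← rpow_mul (hφ0 x).le, ← rpow_mul (hW0 _).le,
        mul_one_div, mul_one_div, div_self hN.ne', rpow_one]
    have h4 : (∏ i, D x i) ^ (1 / (n + 1 : ℝ)) ≤ (∑ i, D x i) / (n + 1) := by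
      have := geom_mean_le_arith_mean_weighted Finset.univ (fun _ : Fin (n + 1) => 1 / (n + 1 : ℝ))
        (D x) (fun _ _ => by positivity) (by simp [hN.ne']) (fun i _ => hD0 x i)
      rw [finsetProd_rpow _ _ fun i _ => hD0 x i, ← Finset.mul_sum] at this
      exact this.trans_eq (by ring)
    calc W (T x) * φ x ^ α = φ x ^ β * (φ x ^ (α / (n + 1)) * W (T x)) := by
          conv_lhs => rw [hαβ, rpow_add (hφ0 x)]
          ring
      _ = φ x ^ β * (c ^ (1 / (n + 1 : ℝ)) * (∏ i, D x i) ^ (1 / (n + 1 : ℝ))) := by rw [h3]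
      _ ≤ φ x ^ β * (c ^ (1 / (n + 1 : ℝ)) * ((∑ i, D x i) / (n + 1))) := by
          have := rpow_nonneg (hφ0 x).le β
          have := rpow_nonneg hc0.le (1 / (n + 1 : ℝ))
          gcongr
      _ = _ := by ring
  have hφα := hrc φ α hφc hφ0
  have hφβ := hrc φ β hφc hφ0
  have hφβ1 := hrc φ (β - 1) hφc hφ0
  have hint : ∫ x, W (T x) * φ x ^ α ∂cubeMeasure (n + 1) R ≤
      ∫ x, c ^ (1 / (n + 1 : ℝ)) / (n + 1) * (φ x ^ β * ∑ i, D x i) ∂cubeMeasure (n + 1) R :=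
    integral_mono_ae ((hWT.mul hφα).integrable_cubeMeasure)
    ((continuous_const.mul (hφβ.mul hDs)).integrable_cubeMeasure) hpoint
  have hlhs : ∫ x, W (T x) * φ x ^ α ∂cubeMeasure (n + 1) R =
      c * ∫ y, W y ^ (-(n : ℝ)) ∂cubeMeasure (n + 1) L := by
    rw [hTpush W hWc, hvint]
    congr 1
    refine integral_congr_ae (Eventually.of_forall fun y => ?_)
    simp only
    rw [show (-(n : ℝ)) = 1 + -(n + 1 : ℝ) by ring, rpow_add (hW0 y), rpow_one]
  rw [integral_const_mul] at hint
  refine (hlhs.symm.trans_le hint).trans (mul_le_mul_of_nonneg_left ?_ (by positivity))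
  have hψ : ∀ x, HasFDerivAt (fun x => φ x ^ β) ((β * φ x ^ (β - 1)) • φ' x) x := fun x =>
    (hφ x).rpow_const (Or.inl (hφ0 x).ne')
  refine (integral_mul_sum_le hR.le (rpow_nonneg hε.le β) hψ
    ((continuous_const.mul hφβ1).smul hφ')
    (fun x i hx => by rw [hface x i hx]) hTc hDc hTcube hTd).trans (add_le_add le_rfl ?_)
  have hJ : ∫ x, (φ x ^ (β - 1) * euclNorm (T x)) ^ q ∂cubeMeasure (n + 1) R =
      c * ∫ y, euclNorm y ^ q * W y ^ (-(n + 1 : ℝ)) ∂cubeMeasure (n + 1) L := by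
    rw [← hvint, ← hTpush (fun y => euclNorm y ^ q)
      (continuous_euclNorm.rpow_const fun _ => Or.inr hq0.le)]
    refine integral_congr_ae (Eventually.of_forall fun x => ?_)
    simp only
    rw [mul_rpow (rpow_nonneg (hφ0 x).le _) (euclNorm_nonneg _), ← rpow_mul (hφ0 x).le, hβq,
      mul_comm]
  rw [← hJ]
  have hH := integral_mul_le_Lp_mul_Lq_of_nonneg hpq (μ := cubeMeasure (n + 1) R)
    (Eventually.of_forall hG0)
    (Eventually.of_forall fun x => mul_nonneg (rpow_nonneg (hφ0 x).le (β - 1))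
      (euclNorm_nonneg (T x)))
    (hG.memLp_cubeMeasure _) ((hφβ1.mul hTn).memLp_cubeMeasure _)
  refine le_trans ?_ (mul_le_mul_of_nonneg_left hH hβ)
  rw [← integral_const_mul]
  refine integral_mono ?_ ?_ fun x => ?_
  · exact (((continuous_const.mul hφβ1).smul hφ').clm_apply hTc).abs.integrable_cubeMeasure
  · exact (continuous_const.mul (hG.mul (hφβ1.mul hTn))).integrable_cubeMeasure
  · have h1 : 0 ≤ β * φ x ^ (β - 1) := mul_nonneg hβ (rpow_nonneg (hφ0 x).le _)
    calc |((β * φ x ^ (β - 1)) • φ' x) (T x)| = β * φ x ^ (β - 1) * |φ' x (T x)| := by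
          rw [smul_apply, smul_eq_mul, abs_mul, abs_of_nonneg h1]
      _ ≤ β * φ x ^ (β - 1) * (G x * euclNorm (T x)) := mul_le_mul_of_nonneg_left (hφG x (T x)) h1
      _ = β * (G x * (φ x ^ (β - 1) * euclNorm (T x))) := by ring

theorem rpow_mul_le_of_transport {N q α β c₀ c I₁ B g J : ℝ} (hq : 0 < q) (hα : 0 < α)
    (hN : 0 < N) (hexp : 1 / α = 1 - 1 / N - 1 / q) (hc₀ : 0 < c₀) (hc : c₀ ≤ c) (hI₁ : 0 ≤ I₁)
    (hB : 0 ≤ B) (hJ : 0 ≤ J)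
    (h : c * I₁ ≤ c ^ (1 / N) / N * (N * B + β * (g * (c * J) ^ (1 / q)))) :
    c₀ ^ (1 / α) * I₁ ≤ c₀ ^ (-(1 / q)) * B + β / N * (g * J ^ (1 / q)) := by
  have hc1 : 0 < c := hc₀.trans_le hc
  rw [mul_rpow hc1.le hJ] at h
  have hcq : c = c ^ (1 / N) * c ^ (1 / q) * c ^ (1 / α) := by
    rw [← rpow_add hc1, ← rpow_add hc1, hexp]
    ring_nf
    rw [rpow_one]
  have hneg : c ^ (-(1 / q)) * c ^ (1 / q) = 1 := by
    rw [← rpow_add hc1]; simp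
  have key : c ^ (1 / N) * c ^ (1 / q) * (c ^ (1 / α) * I₁) ≤
      c ^ (1 / N) * c ^ (1 / q) * (c ^ (-(1 / q)) * B + β / N * (g * J ^ (1 / q))) := by
    calc c ^ (1 / N) * c ^ (1 / q) * (c ^ (1 / α) * I₁) = c * I₁ := by
          nth_rw 4 [hcq]; ring
      _ ≤ _ := h
      _ = c ^ (1 / N) * (c ^ (-(1 / q)) * c ^ (1 / q)) * B +
          c ^ (1 / N) * c ^ (1 / q) * (β / N * (g * J ^ (1 / q))) := by
        rw [hneg]; field_simp
      _ = _ := by ring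
  have key2 := le_of_mul_le_mul_left key (by positivity)
  have h1 : c₀ ^ (1 / α) * I₁ ≤ c ^ (1 / α) * I₁ := by gcongr
  have h2 : c ^ (-(1 / q)) * B ≤ c₀ ^ (-(1 / q)) * B := by
    refine mul_le_mul_of_nonneg_right (rpow_le_rpow_of_nonpos hc₀ hc ?_) hB
    have : 0 < 1 / q := by positivity
    linarith
  linarith

theorem sobolev_cubeMeasure {n : ℕ} {p q α β : ℝ} (hpq : p.HolderConjugate q) (hα : 0 < α)
    (hβ : 0 < β) (hαβ : α = β + α / (n + 1)) (hβq : (β - 1) * q = α)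
    (hexp : 1 / α = 1 - 1 / (n + 1 : ℝ) - 1 / q)
    {R L : ℝ} (hR : 0 < R) (hL : 0 < L) {f : EuclideanSpace ℝ (Fin (n + 1)) → ℝ}
    (hf : ContDiff ℝ 1 f) (hface : ∀ x i, |x i| = R → f x = 0)
    (hA : 0 < ∫ x, |f (WithLp.toLp 2 x)| ^ α ∂cubeMeasure (n + 1) R) :
    ((∫ x, |f (WithLp.toLp 2 x)| ^ α ∂cubeMeasure (n + 1) R) /
        ∫ y, (1 + euclNorm y ^ q) ^ (-(n + 1 : ℝ)) ∂cubeMeasure (n + 1) L) ^ (1 / α) *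
      ∫ y, (1 + euclNorm y ^ q) ^ (-(n : ℝ)) ∂cubeMeasure (n + 1) L ≤
    β / (n + 1) * ((∫ x, ‖fderiv ℝ f (WithLp.toLp 2 x)‖ ^ p ∂cubeMeasure (n + 1) R) ^ (1 / p) *
      (∫ y, euclNorm y ^ q * (1 + euclNorm y ^ q) ^ (-(n + 1 : ℝ)) ∂cubeMeasure (n + 1) L) ^
        (1 / q)) := by
  have hq := hpq.symm.pos
  have hcont : Continuous fun x : Fin (n + 1) → ℝ => f (WithLp.toLp 2 x) :=
    hf.continuous.comp (PiLp.continuous_toLp 2 _)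
  have hbase : ∀ y : Fin (n + 1) → ℝ, 0 < 1 + euclNorm y ^ q := fun y => by
    have := rpow_nonneg (euclNorm_nonneg y) q
    linarith
  have hcontq : Continuous fun y : Fin (n + 1) → ℝ => euclNorm y ^ q :=
    continuous_euclNorm.rpow_const fun _ => Or.inr hq.le
  have hI₀ : 0 < ∫ y, (1 + euclNorm y ^ q) ^ (-(n + 1 : ℝ)) ∂cubeMeasure (n + 1) L :=
    integral_cubeMeasure_pos hL
      ((continuous_const.add hcontq).rpow_const fun y => Or.inl (hbase y).ne')
      fun y => rpow_pos_of_pos (hbase y) _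
  have hI₁ : 0 ≤ ∫ y, (1 + euclNorm y ^ q) ^ (-(n : ℝ)) ∂cubeMeasure (n + 1) L :=
    integral_nonneg fun y => rpow_nonneg (hbase y).le _
  have hJ : 0 ≤ ∫ y, euclNorm y ^ q * (1 + euclNorm y ^ q) ^ (-(n + 1 : ℝ))
      ∂cubeMeasure (n + 1) L :=
    integral_nonneg fun y =>
      mul_nonneg (rpow_nonneg (euclNorm_nonneg y) _) (rpow_nonneg (hbase y).le _)
  set M := (cubeMeasure n R).real Set.univ
  set c₀ := (∫ x, |f (WithLp.toLp 2 x)| ^ α ∂cubeMeasure (n + 1) R) /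
        ∫ y, (1 + euclNorm y ^ q) ^ (-(n + 1 : ℝ)) ∂cubeMeasure (n + 1) L with hc₀def
  have hc₀ : 0 < c₀ := div_pos hA hI₀
  have hM : 0 ≤ M := measureReal_nonneg
  let T : (Fin (n + 1) → ℝ) →L[ℝ] EuclideanSpace ℝ (Fin (n + 1)) :=
    ((PiLp.continuousLinearEquiv 2 ℝ fun _ : Fin (n + 1) => ℝ).symm :
      (Fin (n + 1) → ℝ) →L[ℝ] EuclideanSpace ℝ (Fin (n + 1)))
  have hε : ∀ ε : ℝ, 0 < ε → c₀ ^ (1 / α) *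
      ∫ y, (1 + euclNorm y ^ q) ^ (-(n : ℝ)) ∂cubeMeasure (n + 1) L ≤
      c₀ ^ (-(1 / q)) * (M * (2 * L * ε ^ β)) + β / (n + 1) *
        ((∫ x, ‖fderiv ℝ f (WithLp.toLp 2 x)‖ ^ p ∂cubeMeasure (n + 1) R) ^ (1 / p) *
      (∫ y, euclNorm y ^ q * (1 + euclNorm y ^ q) ^ (-(n + 1 : ℝ)) ∂cubeMeasure (n + 1) L) ^
        (1 / q)) := by
    intro ε hε
    have hsq : ∀ x : EuclideanSpace ℝ (Fin (n + 1)), 0 < f x ^ 2 + ε ^ 2 := fun x => by positivity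
    let φ : (Fin (n + 1) → ℝ) → ℝ := fun x => √(f (T x) ^ 2 + ε ^ 2)
    let φ' : (Fin (n + 1) → ℝ) → (Fin (n + 1) → ℝ) →L[ℝ] ℝ := fun x =>
      (f (T x) / √(f (T x) ^ 2 + ε ^ 2)) • (fderiv ℝ f (T x)).comp T
    have hφpos : ∀ x, 0 < φ x := fun x => sqrt_pos.2 (hsq _)
    have hφf : ∀ x, |f (T x)| ≤ φ x := fun x =>
      abs_le_sqrt (le_add_of_nonneg_right (sq_nonneg ε))
    have hφd : ∀ x, HasFDerivAt φ (φ' x) x := by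
      intro x
      have h1 : HasFDerivAt (fun x => f (T x)) ((fderiv ℝ f (T x)).comp T) x :=
        ((hf.differentiable one_ne_zero) (T x)).hasFDerivAt.comp x T.hasFDerivAt
      have h2 := ((h1.pow 2).add_const (ε ^ 2)).sqrt (hsq _).ne'
      have h3 : φ' x = (1 / (2 * √(f (T x) ^ 2 + ε ^ 2))) • (2 • f (T x) ^ (2 - 1)) •
          (fderiv ℝ f (T x)).comp T := by
        rw [smul_smul]
        change (f (T x) / √(f (T x) ^ 2 + ε ^ 2)) • _ = _
        congr 1
        simp only [Nat.add_one_sub_one, pow_one, nsmul_eq_mul, Nat.cast_ofNat]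
        field_simp
      rw [h3]
      exact h2
    have hTc : Continuous T := T.continuous
    have hfd : Continuous fun x => fderiv ℝ f (T x) :=
      (hf.continuous_fderiv one_ne_zero).comp hTc
    have hφc : Continuous φ := (((hf.continuous.comp hTc).pow 2).add continuous_const).sqrt
    have hφ'c : Continuous φ' := by
      refine Continuous.smul ((hf.continuous.comp hTc).div hφc fun x => (hφpos x).ne') ?_
      exact hfd.clm_comp continuous_const
    have hI : Integrable (fun x => φ x ^ α) (cubeMeasure (n + 1) R) :=
      (hφc.rpow_const fun _ => Or.inr hα.le).integrable_cubeMeasure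
    have hAle : (∫ x, |f (WithLp.toLp 2 x)| ^ α ∂cubeMeasure (n + 1) R) ≤
        ∫ x, φ x ^ α ∂cubeMeasure (n + 1) R :=
      integral_mono (hcont.abs.rpow_const fun _ => Or.inr hα.le).integrable_cubeMeasure hI
        fun x => rpow_le_rpow (abs_nonneg _) (hφf x) hα.le
    refine rpow_mul_le_of_transport (c := (∫ x, φ x ^ α ∂cubeMeasure (n + 1) R) /
      ∫ y, (1 + euclNorm y ^ q) ^ (-(n + 1 : ℝ)) ∂cubeMeasure (n + 1) L) hq hα (by positivity)
      hexp hc₀ (by rw [hc₀def]; gcongr) hI₁ (by positivity) hJ ?_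
    refine rpow_integral_transport_le hpq hα hβ.le hαβ hβq hR hL hε hφd hφ'c ?_ ?_ hfd.norm
      (fun _ => norm_nonneg _) ?_ (div_mul_cancel₀ _ hI₀.ne')
    · intro x
      exact le_sqrt_of_sq_le (by nlinarith [sq_nonneg (f (T x))])
    · intro x i hx
      have : f (T x) = 0 := hface _ i hx
      simp [φ, this, hε.le]
    · intro x y
      have h1 : |f (T x) / φ x| ≤ 1 := by
        rw [abs_div, abs_of_pos (hφpos x)]
        exact div_le_one_of_le₀ (hφf x) (hφpos x).le
      calc |φ' x y| = |f (T x) / φ x| * ‖fderiv ℝ f (T x) (T y)‖ := by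
            simp [φ', φ, abs_mul]
        _ ≤ 1 * (‖fderiv ℝ f (T x)‖ * ‖T y‖) := by
            gcongr
            exact ContinuousLinearMap.le_opNorm _ _
        _ = _ := by rw [one_mul]; rfl
  refine ge_of_tendsto (x := 𝓝[>] (0 : ℝ)) (f := fun ε : ℝ =>
    c₀ ^ (-(1 / q)) * (M * (2 * L * ε ^ β)) + β / (n + 1) *
        ((∫ x, ‖fderiv ℝ f (WithLp.toLp 2 x)‖ ^ p ∂cubeMeasure (n + 1) R) ^ (1 / p) *
      (∫ y, euclNorm y ^ q * (1 + euclNorm y ^ q) ^ (-(n + 1 : ℝ)) ∂cubeMeasure (n + 1) L) ^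
        (1 / q))) ?_ (eventually_mem_nhdsWithin.mono fun ε h => hε ε h)
  have hlim : Tendsto (fun ε : ℝ => ε ^ β) (𝓝[>] 0) (𝓝 0) := by
    have := (continuousAt_rpow_const 0 β (Or.inr hβ.le)).tendsto
    rw [zero_rpow hβ.ne'] at this
    exact this.mono_left nhdsWithin_le_nhds
  have := (((hlim.const_mul (2 * L)).const_mul M).const_mul (c₀ ^ (-(1 / q)))).add_const
    (β / (n + 1) *
        ((∫ x, ‖fderiv ℝ f (WithLp.toLp 2 x)‖ ^ p ∂cubeMeasure (n + 1) R) ^ (1 / p) *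
      (∫ y, euclNorm y ^ q * (1 + euclNorm y ^ q) ^ (-(n + 1 : ℝ)) ∂cubeMeasure (n + 1) L) ^
        (1 / q)))
  simpa using this

theorem lintegral_rpow_mul_exp_neg_mul_Ioi {a r : ℝ} (ha : 0 < a) (hr : 0 < r) :
    ∫⁻ t in Set.Ioi (0 : ℝ), ENNReal.ofReal (t ^ (a - 1) * exp (-(r * t))) =
      ENNReal.ofReal ((1 / r) ^ a * Gamma a) := by
  have h := Real.integral_rpow_mul_exp_neg_mul_Ioi ha hr
  have hint : IntegrableOn (fun t : ℝ => t ^ (a - 1) * exp (-(r * t))) (Set.Ioi 0) := by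
    refine not_imp_comm.1 integral_undef ?_
    rw [h]
    have := Gamma_pos_of_pos ha
    positivity
  rw [← h, ofReal_integral_eq_lintegral_ofReal hint]
  filter_upwards [ae_restrict_mem measurableSet_Ioi] with t ht
  have : 0 < t := ht
  positivity

theorem integral_exp_neg_norm_rpow (n : ℕ) {q : ℝ} (hq : 0 < q) :
    ∫ y : EuclideanSpace ℝ (Fin (n + 1)), exp (-‖y‖ ^ q) =
      √π ^ (n + 1) / Gamma ((n + 1 : ℕ) / 2 + 1) * Gamma ((n + 1 : ℕ) / q + 1) := by
  have h := measure_lt_one_eq_integral_div_gamma (volume : Measure (EuclideanSpace ℝ (Fin (n + 1))))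
    (g := fun x => ‖x‖) norm_zero norm_neg norm_add_le (norm_eq_zero.1)
    (fun r x => (norm_smul r x).le) hq
  have hball : {x : EuclideanSpace ℝ (Fin (n + 1)) | ‖x‖ < 1} = Metric.ball 0 1 := by
    ext; simp
  rw [hball, EuclideanSpace.volume_ball] at h
  have hΓ : 0 < Gamma ((n + 1 : ℕ) / q + 1) := Gamma_pos_of_pos (by positivity)
  have hΓ2 : 0 < Gamma ((n + 1 : ℕ) / 2 + 1 : ℝ) := Gamma_pos_of_pos (by positivity)
  have h0 : 0 ≤ ∫ y : EuclideanSpace ℝ (Fin (n + 1)), exp (-‖y‖ ^ q) :=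
    integral_nonneg fun _ => (exp_pos _).le
  simp only [ENNReal.ofReal_one, one_pow, one_mul, Fintype.card_fin, finrank_euclideanSpace] at h
  rw [ENNReal.ofReal_eq_ofReal_iff (by positivity) (by positivity)] at h
  rw [h]
  field_simp

theorem lintegral_exp_neg_mul_norm_rpow (n : ℕ) {q t : ℝ} (hq : 0 < q) (ht : 0 < t) :
    ∫⁻ y : EuclideanSpace ℝ (Fin (n + 1)), ENNReal.ofReal (exp (-(t * ‖y‖ ^ q))) =
      ENNReal.ofReal (t ^ (-((n + 1 : ℕ) / q)) *
        ∫ y : EuclideanSpace ℝ (Fin (n + 1)), exp (-‖y‖ ^ q)) := by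
  have hC : 0 < ∫ y : EuclideanSpace ℝ (Fin (n + 1)), exp (-‖y‖ ^ q) := by
    rw [integral_exp_neg_norm_rpow n hq]
    have hΓ : 0 < Gamma ((n + 1 : ℕ) / q + 1) := Gamma_pos_of_pos (by positivity)
    have hΓ2 : 0 < Gamma ((n + 1 : ℕ) / 2 + 1 : ℝ) := Gamma_pos_of_pos (by positivity)
    positivity
  have hscale := Measure.integral_comp_smul (volume : Measure (EuclideanSpace ℝ (Fin (n + 1))))
    (fun y => exp (-‖y‖ ^ q)) (t ^ (1 / q))
  have hfun : ∀ y : EuclideanSpace ℝ (Fin (n + 1)),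
      exp (-‖t ^ (1 / q) • y‖ ^ q) = exp (-(t * ‖y‖ ^ q)) := by
    intro y
    rw [norm_smul, norm_of_nonneg (by positivity), mul_rpow (by positivity) (by positivity),
      ← rpow_mul ht.le, one_div_mul_cancel hq.ne', rpow_one]
  simp only [hfun] at hscale
  have hpow : |((t ^ (1 / q)) ^ (n + 1))⁻¹| = t ^ (-((n + 1 : ℕ) / q)) := by
    rw [abs_of_pos (by positivity), ← rpow_natCast, ← rpow_mul ht.le, rpow_neg ht.le]
    congr 2
    ring
  rw [finrank_euclideanSpace, Fintype.card_fin, hpow, smul_eq_mul] at hscale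
  rw [← hscale, ofReal_integral_eq_lintegral_ofReal]
  · refine not_imp_comm.1 integral_undef ?_
    rw [hscale]
    positivity
  · exact Eventually.of_forall fun _ => (exp_pos _).le

theorem lintegral_one_add_norm_rpow (n : ℕ) {q k : ℝ} (hq : 0 < q) (hk : (n + 1 : ℕ) / q < k) :
    ∫⁻ y : EuclideanSpace ℝ (Fin (n + 1)), ENNReal.ofReal ((1 + ‖y‖ ^ q) ^ (-k)) =
      ENNReal.ofReal ((∫ y : EuclideanSpace ℝ (Fin (n + 1)), exp (-‖y‖ ^ q)) *
        Gamma (k - (n + 1 : ℕ) / q) / Gamma k) := by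
  have hk0 : 0 < k := lt_trans (by positivity) hk
  have hΓk := Gamma_pos_of_pos hk0
  have hΓ := Gamma_pos_of_pos (sub_pos.2 hk)
  set C := ∫ y : EuclideanSpace ℝ (Fin (n + 1)), exp (-‖y‖ ^ q)
  have hC : 0 ≤ C := integral_nonneg fun _ => (exp_pos _).le
  have hswap : ∫⁻ y : EuclideanSpace ℝ (Fin (n + 1)), ∫⁻ t in Set.Ioi (0 : ℝ),
        ENNReal.ofReal (t ^ (k - 1) * exp (-((1 + ‖y‖ ^ q) * t))) =
      ∫⁻ t in Set.Ioi (0 : ℝ), ∫⁻ y : EuclideanSpace ℝ (Fin (n + 1)),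
        ENNReal.ofReal (t ^ (k - 1) * exp (-((1 + ‖y‖ ^ q) * t))) := by
    refine lintegral_lintegral_swap (Measurable.aemeasurable ?_)
    unfold Function.uncurry
    fun_prop
  have hleft : ∀ y : EuclideanSpace ℝ (Fin (n + 1)), ∫⁻ t in Set.Ioi (0 : ℝ),
        ENNReal.ofReal (t ^ (k - 1) * exp (-((1 + ‖y‖ ^ q) * t))) =
      ENNReal.ofReal (Gamma k) * ENNReal.ofReal ((1 + ‖y‖ ^ q) ^ (-k)) := by
    intro y
    have hy : 0 < 1 + ‖y‖ ^ q := by positivity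
    rw [lintegral_rpow_mul_exp_neg_mul_Ioi hk0 hy, ← ENNReal.ofReal_mul hΓk.le, one_div,
      inv_rpow hy.le, ← rpow_neg hy.le, mul_comm]
  have hright : ∀ t ∈ Set.Ioi (0 : ℝ), ∫⁻ y : EuclideanSpace ℝ (Fin (n + 1)),
        ENNReal.ofReal (t ^ (k - 1) * exp (-((1 + ‖y‖ ^ q) * t))) =
      ENNReal.ofReal C * ENNReal.ofReal (t ^ (k - (n + 1 : ℕ) / q - 1) * exp (-(1 * t))) := by
    intro t ht
    have ht : 0 < t := ht
    have hsplit : ∀ y : EuclideanSpace ℝ (Fin (n + 1)),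
        ENNReal.ofReal (t ^ (k - 1) * exp (-((1 + ‖y‖ ^ q) * t))) =
          ENNReal.ofReal (t ^ (k - 1) * exp (-t)) * ENNReal.ofReal (exp (-(t * ‖y‖ ^ q))) := by
      intro y
      rw [← ENNReal.ofReal_mul (by positivity), mul_assoc, ← exp_add]
      congr 3
      ring
    simp only [hsplit]
    rw [lintegral_const_mul _ (by fun_prop), lintegral_exp_neg_mul_norm_rpow n hq ht,
      ← ENNReal.ofReal_mul (by positivity), ← ENNReal.ofReal_mul hC,
      show k - (n + 1 : ℕ) / q - 1 = k - 1 + -((n + 1 : ℕ) / q) by ring, rpow_add ht, one_mul]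
    congr 1
    ring
  simp only [hleft] at hswap
  rw [setLIntegral_congr_fun measurableSet_Ioi hright, lintegral_const_mul _ (by fun_prop),
    lintegral_const_mul _ (by fun_prop),
    lintegral_rpow_mul_exp_neg_mul_Ioi (sub_pos.2 hk) one_pos] at hswap
  rw [div_one, one_rpow, one_mul, ← ENNReal.ofReal_mul hC] at hswap
  rw [ENNReal.ofReal_div_of_pos hΓk, ← hswap, mul_comm, ENNReal.mul_div_cancel_right]
  · simpa using hΓk
  · simp

theorem integrable_one_add_norm_rpow (n : ℕ) {q k : ℝ} (hq : 0 < q)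
    (hk : (n + 1 : ℕ) / q < k) :
    Integrable fun y : EuclideanSpace ℝ (Fin (n + 1)) => (1 + ‖y‖ ^ q) ^ (-k) := by
  refine ⟨Measurable.aestronglyMeasurable (by fun_prop), ?_⟩
  rw [hasFiniteIntegral_iff_ofReal (Eventually.of_forall fun y => by positivity),
    lintegral_one_add_norm_rpow n hq hk]
  exact ENNReal.ofReal_lt_top

theorem integral_one_add_norm_rpow (n : ℕ) {q k : ℝ} (hq : 0 < q) (hk : (n + 1 : ℕ) / q < k) :
    ∫ y : EuclideanSpace ℝ (Fin (n + 1)), (1 + ‖y‖ ^ q) ^ (-k) =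
      √π ^ (n + 1) / Gamma ((n + 1 : ℕ) / 2 + 1) * Gamma ((n + 1 : ℕ) / q + 1) *
        Gamma (k - (n + 1 : ℕ) / q) / Gamma k := by
  have hk0 : 0 < k := lt_trans (by positivity) hk
  have hΓk := Gamma_pos_of_pos hk0
  have hΓ := Gamma_pos_of_pos (sub_pos.2 hk)
  have hΓ3 : 0 < Gamma ((n + 1 : ℕ) / q + 1) := Gamma_pos_of_pos (by positivity)
  have hΓ2 : 0 < Gamma ((n + 1 : ℕ) / 2 + 1 : ℝ) := Gamma_pos_of_pos (by positivity)
  rw [integral_eq_lintegral_of_nonneg_ae (Eventually.of_forall fun y => by positivity)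
    (Measurable.aestronglyMeasurable (by fun_prop)), lintegral_one_add_norm_rpow n hq hk, integral_exp_neg_norm_rpow n hq,
    ENNReal.toReal_ofReal (by positivity)]

theorem integral_one_add_norm_rpow_succ (n : ℕ) {q : ℝ} (hq : 0 < q)
    (hn : (n + 1 : ℕ) / q < n) :
    ∫ y : EuclideanSpace ℝ (Fin (n + 1)), (1 + ‖y‖ ^ q) ^ (-(n : ℝ)) =
      n / (n - (n + 1 : ℕ) / q) *
        ∫ y : EuclideanSpace ℝ (Fin (n + 1)), (1 + ‖y‖ ^ q) ^ (-(n + 1 : ℝ)) := by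
  have hn0 : (0 : ℝ) < n := lt_trans (by positivity) hn
  have hd : 0 < n - (n + 1 : ℕ) / q := sub_pos.2 hn
  have hΓ := Gamma_pos_of_pos hd
  have hΓn := Gamma_pos_of_pos hn0
  have hΓ2 : 0 < Gamma ((n + 1 : ℕ) / 2 + 1 : ℝ) := Gamma_pos_of_pos (by positivity)
  rw [integral_one_add_norm_rpow n hq hn, integral_one_add_norm_rpow n hq (hn.trans (lt_add_one _)),
    Gamma_add_one hn0.ne', show (n + 1 : ℝ) - (n + 1 : ℕ) / q = n - (n + 1 : ℕ) / q + 1 by ring,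
    Gamma_add_one hd.ne']
  generalize (n : ℝ) - (n + 1 : ℕ) / q = d at hd hΓ
  field_simp

theorem integral_norm_rpow_mul_one_add_norm_rpow (n : ℕ) {q : ℝ} (hq : 0 < q)
    (hn : (n + 1 : ℕ) / q < n) :
    ∫ y : EuclideanSpace ℝ (Fin (n + 1)), ‖y‖ ^ q * (1 + ‖y‖ ^ q) ^ (-(n + 1 : ℝ)) =
      (∫ y : EuclideanSpace ℝ (Fin (n + 1)), (1 + ‖y‖ ^ q) ^ (-(n : ℝ))) -
        ∫ y : EuclideanSpace ℝ (Fin (n + 1)), (1 + ‖y‖ ^ q) ^ (-(n + 1 : ℝ)) := by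
  rw [← integral_sub (integrable_one_add_norm_rpow n hq hn)
    (integrable_one_add_norm_rpow n hq (hn.trans (lt_add_one _)))]
  congr 1 with y
  have hy : 0 < 1 + ‖y‖ ^ q := by positivity
  rw [show -(n : ℝ) = -(n + 1) + 1 by ring, rpow_add hy, rpow_one]
  ring

theorem integrable_norm_rpow_mul_one_add_norm_rpow (n : ℕ) {q : ℝ} (hq : 0 < q)
    (hn : (n + 1 : ℕ) / q < n) :
    Integrable fun y : EuclideanSpace ℝ (Fin (n + 1)) =>
      ‖y‖ ^ q * (1 + ‖y‖ ^ q) ^ (-(n + 1 : ℝ)) := by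
  refine ((integrable_one_add_norm_rpow n hq hn).sub
    (integrable_one_add_norm_rpow n hq (hn.trans (lt_add_one _)))).congr (ae_of_all _ fun y => ?_)
  have hy : 0 < 1 + ‖y‖ ^ q := by positivity
  simp only [Pi.sub_apply]
  rw [show -(n : ℝ) = -(n + 1) + 1 by ring, rpow_add hy, rpow_one]
  ring

theorem AT_eq (n : ℕ) {p q : ℝ} (hpq : p.HolderConjugate q) :
    AT (n + 1) p = ((n : ℝ) + 1) ^ (-(1 / p)) * ((p - 1) / ((n : ℝ) + 1 - p)) ^ (1 / q) *
      (∫ y : EuclideanSpace ℝ (Fin (n + 1)), (1 + ‖y‖ ^ q) ^ (-(n + 1 : ℝ))) ^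
        (-(1 / (n + 1 : ℝ))) := by
  have hq := hpq.symm.pos
  have hp := hpq.pos
  have hqe : p / (p - 1) = q := hpq.conjugate_eq.symm
  have hinv : 1 / q = 1 - 1 / p := by
    have := hpq.inv_add_inv_eq_one
    simp only [one_div]; linarith
  have hNq : (n + 1 : ℝ) - (n + 1 : ℕ) / q = (n + 1 : ℕ) / p := by
    rw [div_eq_mul_one_div _ q, hinv]; push_cast; ring
  have hlt : ((n + 1 : ℕ) : ℝ) / q < n + 1 := by
    have : 0 < ((n + 1 : ℕ) : ℝ) / p := by positivity
    linarith
  have h1 : 0 < Gamma ((n + 1 : ℕ) / 2 + 1 : ℝ) := Gamma_pos_of_pos (by positivity)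
  have h2 : 0 < Gamma ((n + 1 : ℕ) / q + 1 : ℝ) := Gamma_pos_of_pos (by positivity)
  have h3 : 0 < Gamma ((n + 1 : ℕ) / p : ℝ) := Gamma_pos_of_pos (by positivity)
  have h4 : 0 < Gamma (n + 1 : ℝ) := Gamma_pos_of_pos (by positivity)
  rw [integral_one_add_norm_rpow n hq hlt, hNq, AT, hqe]
  have hcast : ((n + 1 : ℕ) : ℝ) = n + 1 := by push_cast; ring
  rw [add_comm 1 (((n + 1 : ℕ) : ℝ) / 2), add_comm 1 (((n + 1 : ℕ) : ℝ) / q)]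
  have hpi : π ^ (-(1 : ℝ) / 2) = (√π ^ (n + 1)) ^ (-(1 / (n + 1 : ℝ))) := by
    rw [sqrt_eq_rpow, ← rpow_natCast, ← rpow_mul pi_pos.le, ← rpow_mul pi_pos.le, hcast]
    congr 1
    field_simp
  have hinvΓ : √π ^ (n + 1) / Gamma ((n + 1 : ℕ) / 2 + 1) * Gamma ((n + 1 : ℕ) / q + 1) *
      Gamma ((n + 1 : ℕ) / p) / Gamma (n + 1) = √π ^ (n + 1) *
      (Gamma ((n + 1 : ℕ) / 2 + 1) * Gamma (n + 1) /
        (Gamma ((n + 1 : ℕ) / p) * Gamma ((n + 1 : ℕ) / q + 1)))⁻¹ := by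
    field_simp
  rw [hinvΓ, mul_rpow (by positivity) (by positivity), hpi, inv_rpow (by positivity),
    ← rpow_neg (by positivity), neg_neg, hcast]
  ring

theorem AT_mul_eq (n : ℕ) {p q α β : ℝ} (hpq : p.HolderConjugate q) (hpn : p < n + 1)
    (hα : α = p * (n + 1) / (n + 1 - p)) (hβ : β = p * n / (n + 1 - p)) :
    β / (n + 1) * (∫ y : EuclideanSpace ℝ (Fin (n + 1)),
        ‖y‖ ^ q * (1 + ‖y‖ ^ q) ^ (-(n + 1 : ℝ))) ^ (1 / q) =
      AT (n + 1) p *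
        (∫ y : EuclideanSpace ℝ (Fin (n + 1)), (1 + ‖y‖ ^ q) ^ (-(n + 1 : ℝ))) ^ (-(1 / α)) *
        ∫ y : EuclideanSpace ℝ (Fin (n + 1)), (1 + ‖y‖ ^ q) ^ (-(n : ℝ)) := by
  have hq := hpq.symm.pos
  have hp := hpq.pos
  have hp1 := hpq.lt
  have hd : 0 < (n : ℝ) + 1 - p := by linarith
  have hinv : 1 / q = 1 - 1 / p := by
    have := hpq.inv_add_inv_eq_one
    simp only [one_div]; linarith
  have hNq : (n : ℝ) - (n + 1 : ℕ) / q = (n + 1 - p) / p := by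
    rw [div_eq_mul_one_div _ q, hinv]; push_cast; field_simp; ring
  have hlt : ((n + 1 : ℕ) : ℝ) / q < n := by
    have : 0 < (n + 1 - p) / p := by positivity
    linarith
  have hlt' : ((n + 1 : ℕ) : ℝ) / q < n + 1 := by linarith
  have h2 : 0 < Gamma ((n + 1 : ℕ) / q + 1 : ℝ) := Gamma_pos_of_pos (by positivity)
  have h1 : 0 < Gamma ((n + 1 : ℕ) / 2 + 1 : ℝ) := Gamma_pos_of_pos (by positivity)
  have h3 : 0 < Gamma (n + 1 - (n + 1 : ℕ) / q : ℝ) := Gamma_pos_of_pos (by linarith)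
  have h4 : 0 < Gamma (n + 1 : ℝ) := Gamma_pos_of_pos (by positivity)
  rw [integral_norm_rpow_mul_one_add_norm_rpow n hq hlt, integral_one_add_norm_rpow_succ n hq hlt,
    AT_eq n hpq, hNq]
  have hI : 0 < ∫ y : EuclideanSpace ℝ (Fin (n + 1)), (1 + ‖y‖ ^ q) ^ (-(n + 1 : ℝ)) := by
    rw [integral_one_add_norm_rpow n hq hlt']
    positivity
  generalize (∫ y : EuclideanSpace ℝ (Fin (n + 1)), (1 + ‖y‖ ^ q) ^ (-(n + 1 : ℝ))) = I at hI
  have hβ' : n / ((n + 1 - p) / p) = β := by rw [hβ]; field_simp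
  have hβ1 : β * I - I = (n + 1) * ((p - 1) / (n + 1 - p) * I) := by
    rw [hβ]; field_simp; ring
  have hpp : 0 < (p - 1) / (n + 1 - p) := div_pos (by linarith) hd
  have hexp : 1 / q = -(1 / (n + 1 : ℝ)) + (-(1 / α)) + 1 := by
    rw [hinv, hα]; field_simp; ring
  have hN : ((n : ℝ) + 1) ^ (1 / q) = (n + 1 : ℝ) ^ (-(1 / p)) * (n + 1) := by
    rw [show 1 / q = -(1 / p) + 1 by rw [hinv]; ring, rpow_add (by positivity), rpow_one]
  have hIq : I ^ (1 / q) = I ^ (-(1 / (n + 1 : ℝ))) * I ^ (-(1 / α)) * I := by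
    rw [hexp, rpow_add hI, rpow_add hI, rpow_one]
  rw [hβ', hβ1, mul_rpow (by positivity) (by positivity), mul_rpow hpp.le hI.le, hN, hIq]
  field_simp

theorem integral_toLp_cubeMeasure (n : ℕ) (R : ℝ) (h : EuclideanSpace ℝ (Fin n) → ℝ) :
    ∫ x, h (WithLp.toLp 2 x) ∂cubeMeasure n R =
      ∫ x in {x : EuclideanSpace ℝ (Fin n) | ∀ i, x i ∈ Set.Ioc (-R) R}, h x := by
  rw [cubeMeasure_eq_restrict, ← (PiLp.volume_preserving_toLp (Fin n)).setIntegral_preimage_emb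
    (MeasurableEquiv.toLp 2 (Fin n → ℝ)).measurableEmbedding]
  congr 2
  ext x
  simp

theorem setIntegral_tendsto_integral_cube {n : ℕ} {h : EuclideanSpace ℝ (Fin n) → ℝ}
    (hh : Integrable h) :
    Tendsto (fun m : ℕ => ∫ x in {x : EuclideanSpace ℝ (Fin n) |
      ∀ i, x i ∈ Set.Ioc (-(m + 1 : ℝ)) (m + 1)}, h x) atTop (𝓝 (∫ x, h x)) := by
  have huniv : ⋃ m : ℕ, {x : EuclideanSpace ℝ (Fin n) |
      ∀ i, x i ∈ Set.Ioc (-(m + 1 : ℝ)) (m + 1)} = Set.univ := by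
    refine Set.eq_univ_of_forall fun x => Set.mem_iUnion.2 ?_
    obtain ⟨m, hm⟩ := exists_nat_ge ‖x‖
    refine ⟨m, fun i => ?_⟩
    have h1 : |x i| ≤ ‖x‖ := PiLp.norm_apply_le x i
    have h2 := abs_le.1 (h1.trans hm)
    constructor <;> linarith [h2.1, h2.2]
  have := tendsto_setIntegral_of_monotone (μ := volume) (f := h)
    (s := fun m : ℕ => {x : EuclideanSpace ℝ (Fin n) |
      ∀ i, x i ∈ Set.Ioc (-(m + 1 : ℝ)) (m + 1)}) (fun m => ?_) ?_ hh.integrableOn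
  · rwa [huniv, setIntegral_univ] at this
  · have hset : {x : EuclideanSpace ℝ (Fin n) | ∀ i, x i ∈ Set.Ioc (-(m + 1 : ℝ)) (m + 1)} =
        ⋂ i, (fun x : EuclideanSpace ℝ (Fin n) => x i) ⁻¹' Set.Ioc (-(m + 1 : ℝ)) (m + 1) := by
      ext x; simp
    rw [hset]
    exact MeasurableSet.iInter fun i => measurableSet_Ioc.preimage (by fun_prop)
  · intro a b hab x hx i
    have hab' : (a : ℝ) ≤ b := by exact_mod_cast hab
    have := hx i
    constructor <;> linarith [this.1, this.2]

theorem HasCompactSupport.exists_cube {n : ℕ} {f : EuclideanSpace ℝ (Fin n) → ℝ}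
    (hf : HasCompactSupport f) :
    ∃ R : ℝ, 0 < R ∧ ∀ x i, R ≤ |x i| → x ∉ tsupport f := by
  obtain ⟨r, hr⟩ := hf.isCompact.isBounded.exists_norm_le
  refine ⟨|r| + 1, by positivity, fun x i hx hmem => ?_⟩
  have h1 : |x i| ≤ ‖x‖ := PiLp.norm_apply_le x i
  linarith [hr x hmem, le_abs_self r]

theorem integral_cubeMeasure_eq_integral {n : ℕ} {R : ℝ} {h : EuclideanSpace ℝ (Fin n) → ℝ}
    (hh : ∀ x i, R ≤ |x i| → h x = 0) :
    ∫ x, h (WithLp.toLp 2 x) ∂cubeMeasure n R = ∫ x, h x := by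
  rw [integral_toLp_cubeMeasure]
  refine setIntegral_eq_integral_of_forall_compl_eq_zero fun x hx => ?_
  simp only [Set.mem_ofPred_eq, not_forall] at hx
  obtain ⟨i, hi⟩ := hx
  refine hh x i ?_
  by_contra hlt
  exact hi ⟨(abs_lt.1 (not_le.1 hlt)).1, (abs_lt.1 (not_le.1 hlt)).2.le⟩

theorem sharp_Lp_sobolev_succ {n : ℕ} {p q α β : ℝ} (hpq : p.HolderConjugate q)
    (hpn : p < n + 1) (hα : α = p * (n + 1) / (n + 1 - p)) (hβ : β = p * n / (n + 1 - p))
    (hn : 0 < n) {f : EuclideanSpace ℝ (Fin (n + 1)) → ℝ} (hf : ContDiff ℝ 1 f)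
    (hsupp : HasCompactSupport f) :
    (∫ x, |f x| ^ α) ^ (1 / α) ≤ AT (n + 1) p * (∫ x, ‖fderiv ℝ f x‖ ^ p) ^ (1 / p) := by
  have hp := hpq.pos
  have hq := hpq.symm.pos
  have hp1 := hpq.lt
  have hd : 0 < (n : ℝ) + 1 - p := by linarith
  have hn0 : (0 : ℝ) < n := by exact_mod_cast hn
  have hα0 : 0 < α := by rw [hα]; positivity
  have hβ0 : 0 < β := by rw [hβ]; positivity
  have hqe : q = p / (p - 1) := hpq.conjugate_eq
  have hpm : 0 < p - 1 := by linarith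
  have hinv : 1 / q = 1 - 1 / p := by
    have := hpq.inv_add_inv_eq_one
    simp only [one_div]; linarith
  have hαβ : α = β + α / (n + 1) := by rw [hα, hβ]; field_simp
  have hβq : (β - 1) * q = α := by rw [hα, hβ, hqe]; field_simp; ring
  have hexp : 1 / α = 1 - 1 / (n + 1 : ℝ) - 1 / q := by
    rw [hinv, hα]; field_simp; ring
  have hlt : ((n + 1 : ℕ) : ℝ) / q < n := by
    have h1 : 0 < (n + 1 - p) / p := by positivity
    have h2 : (n : ℝ) - (n + 1 : ℕ) / q = (n + 1 - p) / p := by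
      rw [div_eq_mul_one_div _ q, hinv]; push_cast; field_simp; ring
    linarith
  have hconst := AT_mul_eq n hpq hpn hα hβ
  have hi₀ := integrable_one_add_norm_rpow n hq (hlt.trans (lt_add_one _))
  have hi₁ := integrable_one_add_norm_rpow n hq hlt
  have hiJ := integrable_norm_rpow_mul_one_add_norm_rpow n hq hlt
  set g := (∫ x, ‖fderiv ℝ f x‖ ^ p) ^ (1 / p)
  set A := ∫ x, |f x| ^ α
  set I₀ := ∫ y : EuclideanSpace ℝ (Fin (n + 1)), (1 + ‖y‖ ^ q) ^ (-(n + 1 : ℝ))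
  set I₁ := ∫ y : EuclideanSpace ℝ (Fin (n + 1)), (1 + ‖y‖ ^ q) ^ (-(n : ℝ))
  set J := ∫ y : EuclideanSpace ℝ (Fin (n + 1)), ‖y‖ ^ q * (1 + ‖y‖ ^ q) ^ (-(n + 1 : ℝ))
  have hg : 0 ≤ g := by positivity
  have hpos : ∀ k : ℝ, (n + 1 : ℕ) / q < k →
      0 < ∫ y : EuclideanSpace ℝ (Fin (n + 1)), (1 + ‖y‖ ^ q) ^ (-k) := by
    intro k hk
    have h0 : 0 < k := lt_trans (by positivity) hk
    have h1 : 0 < Gamma ((n + 1 : ℕ) / q + 1 : ℝ) := Gamma_pos_of_pos (by positivity)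
    have h2 : 0 < Gamma ((n + 1 : ℕ) / 2 + 1 : ℝ) := Gamma_pos_of_pos (by positivity)
    have h3 := Gamma_pos_of_pos (sub_pos.2 hk)
    have h4 := Gamma_pos_of_pos h0
    rw [integral_one_add_norm_rpow n hq hk]
    positivity
  have hI₀ : 0 < I₀ := hpos _ (hlt.trans (lt_add_one _))
  have hI₁ : 0 < I₁ := hpos _ hlt
  have hJ0 : 0 ≤ J := integral_nonneg fun y => by positivity
  have hA0 : 0 ≤ A := integral_nonneg fun y => by positivity
  have hAT : 0 ≤ AT (n + 1) p := by
    rw [AT_eq n hpq]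
    positivity
  rcases hA0.eq_or_lt with hA | hA
  · rw [← hA, zero_rpow (by positivity)]
    positivity
  obtain ⟨R, hR, hcube⟩ := hsupp.exists_cube
  have hf0 : ∀ x i, R ≤ |x i| → f x = 0 := fun x i h =>
    image_eq_zero_of_notMem_tsupport (hcube x i h)
  have hf'0 : ∀ x i, R ≤ |x i| → fderiv ℝ f x = 0 := fun x i h =>
    Function.notMem_support.1 fun hx => hcube x i h (support_fderiv_subset ℝ hx)
  have hAR : ∫ x, |f (WithLp.toLp 2 x)| ^ α ∂cubeMeasure (n + 1) R = A :=
    integral_cubeMeasure_eq_integral (h := fun x => |f x| ^ α) fun x i h => by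
      simp [hf0 x i h, hα0.ne']
  have hgR : ∫ x, ‖fderiv ℝ f (WithLp.toLp 2 x)‖ ^ p ∂cubeMeasure (n + 1) R =
      ∫ x, ‖fderiv ℝ f x‖ ^ p :=
    integral_cubeMeasure_eq_integral (h := fun x => ‖fderiv ℝ f x‖ ^ p) fun x i h => by
      simp [hf'0 x i h, hp.ne']
  have hstep : ∀ m : ℕ, (A / I₀) ^ (1 / α) * ∫ x in {x : EuclideanSpace ℝ (Fin (n + 1)) |
      ∀ i, x i ∈ Set.Ioc (-(m + 1 : ℝ)) (m + 1)}, (1 + ‖x‖ ^ q) ^ (-(n : ℝ)) ≤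
      β / (n + 1) * (g * J ^ (1 / q)) := by
    intro m
    have hL : (0 : ℝ) < m + 1 := by positivity
    have key := sobolev_cubeMeasure hpq hα0 hβ0 hαβ hβq hexp hR hL hf
      (fun x i h => hf0 x i h.ge) (hAR ▸ hA)
    rw [hAR, hgR] at key
    have e₀ := integral_toLp_cubeMeasure (n + 1) (m + 1) fun x => (1 + ‖x‖ ^ q) ^ (-(n + 1 : ℝ))
    have e₁ := integral_toLp_cubeMeasure (n + 1) (m + 1) fun x => (1 + ‖x‖ ^ q) ^ (-(n : ℝ))
    have eJ := integral_toLp_cubeMeasure (n + 1) (m + 1) fun x =>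
      ‖x‖ ^ q * (1 + ‖x‖ ^ q) ^ (-(n + 1 : ℝ))
    have hI₀L : 0 < ∫ y, (1 + euclNorm y ^ q) ^ (-(n + 1 : ℝ)) ∂cubeMeasure (n + 1) (m + 1) := by
      have hbase : ∀ y : Fin (n + 1) → ℝ, 0 < 1 + euclNorm y ^ q := fun y => by
        have := rpow_nonneg (euclNorm_nonneg y) q
        linarith
      exact integral_cubeMeasure_pos hL ((continuous_const.add (continuous_euclNorm.rpow_const
        fun _ => Or.inr hq.le)).rpow_const fun y => Or.inl (hbase y).ne')
        fun y => rpow_pos_of_pos (hbase y) _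
    unfold euclNorm at key hI₀L
    rw [e₀] at hI₀L
    rw [e₀, e₁, eJ] at key
    refine le_trans ?_ (key.trans ?_)
    · refine mul_le_mul_of_nonneg_right ?_ (integral_nonneg fun y => by positivity)
      gcongr
      exact setIntegral_le_integral hi₀ (ae_of_all _ fun y => by positivity)
    · gcongr
      exact setIntegral_le_integral hiJ (ae_of_all _ fun y => by positivity)
  have hfinal : (A / I₀) ^ (1 / α) * I₁ ≤ β / (n + 1) * (g * J ^ (1 / q)) :=
    le_of_tendsto ((setIntegral_tendsto_integral_cube hi₁).const_mul _)
      (Eventually.of_forall hstep)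
  have hrew : β / (n + 1) * (g * J ^ (1 / q)) =
      (AT (n + 1) p * g) * I₀ ^ (-(1 / α)) * I₁ := by
    rw [← mul_left_comm, hconst]; ring
  rw [hrew, div_rpow hA0 hI₀.le, div_eq_mul_inv, ← rpow_neg hI₀.le] at hfinal
  exact le_of_mul_le_mul_right (le_of_mul_le_mul_right hfinal hI₁) (by positivity)

/-- Sharp `L^p`-Sobolev inequality in `ℝ^n` (Euclidean case of Theorem 1.1). -/
theorem sharp_Lp_sobolev_euclidean (n : ℕ) (hn : 2 ≤ n) (p : ℝ) (hp : 1 < p) (hpn : p < n)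
    (f : EuclideanSpace ℝ (Fin n) → ℝ) (hf : ContDiff ℝ (⊤ : ℕ∞) f)
    (hsupp : HasCompactSupport f) :
    (∫ x : EuclideanSpace ℝ (Fin n), |f x| ^ (p * n / ((n : ℝ) - p))) ^ (((n : ℝ) - p) / (p * n)) ≤
      AT n p * (∫ x : EuclideanSpace ℝ (Fin n), ‖fderiv ℝ f x‖ ^ p) ^ (1 / p) := by
  obtain ⟨m, rfl⟩ : ∃ m, n = m + 1 := ⟨n - 1, by omega⟩
  have hcast : ((m + 1 : ℕ) : ℝ) = m + 1 := by push_cast; ring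
  have h := sharp_Lp_sobolev_succ (Real.HolderConjugate.conjExponent hp) (hcast ▸ hpn) rfl rfl
    (by omega) (hf.of_le (by exact_mod_cast le_top)) hsupp
  rwa [one_div_div, ← hcast] at h
end

section
/- Let n ≥ 2 be an integer. For every smooth compactly supported function f : ℝ^n → ℝ one has (∫_{ℝ^n} |f|^{n/(n-1)} dx)^{(n-1)/n} ≤ n^{-1} ω_n^{-1/n} ∫_{ℝ^n} |∇f| dx. -/
open Real MeasureTheory Filter Topology

open scoped ENNReal

section PrekopaLeindler

open scoped Pointwise

/-- The Brunn–Minkowski inequality for compact subsets of the real line. -/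
lemma IsCompact.volume_add_volume_le {K L C : Set ℝ} (hK : IsCompact K) (hL : IsCompact L)
    (hKne : K.Nonempty) (hLne : L.Nonempty) (h : ∀ x ∈ K, ∀ y ∈ L, x + y ∈ C) :
    volume K + volume L ≤ volume C := by
  obtain ⟨l, hl, hlmin⟩ := hL.exists_isLeast hLne
  obtain ⟨k, hk, hkmax⟩ := hK.exists_isGreatest hKne
  have hKl : IsCompact ((fun x => x + l) '' K) := hK.image (by fun_prop)
  have hkL : IsCompact ((fun y => k + y) '' L) := hL.image (by fun_prop)
  have hdisj : AEDisjoint volume ((fun x => x + l) '' K) ((fun y => k + y) '' L) := by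
    refine measure_mono_null (t := {k + l}) ?_ (by simp)
    rintro _ ⟨⟨x, hx, rfl⟩, ⟨y, hy, hxy⟩⟩
    have h1 := hkmax hx
    have h2 := hlmin hy
    simp only [Set.mem_singleton_iff] at *
    linarith
  calc volume K + volume L
      = volume ((fun x => x + l) '' K) + volume ((fun y => k + y) '' L) := by simp
    _ = volume ((fun x => x + l) '' K ∪ (fun y => k + y) '' L) :=
        (measure_union₀ hkL.measurableSet.nullMeasurableSet hdisj).symm
    _ ≤ volume C := by
        refine measure_mono (Set.union_subset ?_ ?_)
        · rintro _ ⟨x, hx, rfl⟩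
          exact h x hx l hl
        · rintro _ ⟨y, hy, rfl⟩
          exact h k hk y hy

lemma MeasurableSet.measure_le_iSup_isCompact_nonempty {A : Set ℝ} (hA : MeasurableSet A)
    (hne : A.Nonempty) :
    volume A ≤ ⨆ (K : Set ℝ) (_ : K ⊆ A ∧ IsCompact K ∧ K.Nonempty), volume K := by
  obtain ⟨a, ha⟩ := hne
  rw [hA.measure_eq_iSup_isCompact]
  refine iSup_le fun K => iSup_le fun hKA => iSup_le fun hK => ?_
  refine le_trans (measure_mono (Set.subset_insert a K)) ?_
  exact le_iSup₂_of_le (insert a K)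
    ⟨Set.insert_subset ha hKA, hK.insert a, Set.insert_nonempty a K⟩ le_rfl

/-- The Brunn–Minkowski inequality on the real line. -/
lemma MeasurableSet.volume_add_volume_le {A B C : Set ℝ} (hA : MeasurableSet A)
    (hB : MeasurableSet B) (hAne : A.Nonempty) (hBne : B.Nonempty)
    (h : ∀ x ∈ A, ∀ y ∈ B, x + y ∈ C) : volume A + volume B ≤ volume C := by
  obtain ⟨a, ha⟩ := hAne
  obtain ⟨b, hb⟩ := hBne
  refine (add_le_add (hA.measure_le_iSup_isCompact_nonempty ⟨a, ha⟩)
    (hB.measure_le_iSup_isCompact_nonempty ⟨b, hb⟩)).trans ?_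
  refine ENNReal.biSup_add_biSup_le' ⟨{a}, by simpa⟩ ⟨{b}, by simpa⟩ ?_
  rintro K ⟨hKA, hK, hKne⟩ L ⟨hLB, hL, hLne⟩
  exact hK.volume_add_volume_le hL hKne hLne fun x hx y hy => h x (hKA hx) y (hLB hy)

lemma ENNReal.rpow_mul_rpow_le_add {a b : ℝ} (ha : 0 < a) (hb : 0 < b) (hab : a + b = 1)
    (x y : ℝ≥0∞) :
    x ^ a * y ^ b ≤ ENNReal.ofReal a * x + ENNReal.ofReal b * y := by
  by_cases hx : x = ∞
  · simp [hx, ENNReal.mul_top, ha]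
  by_cases hy : y = ∞
  · simp [hy, ENNReal.mul_top, hb]
  lift x to NNReal using hx
  lift y to NNReal using hy
  lift a to NNReal using ha.le
  lift b to NNReal using hb.le
  have := NNReal.geom_mean_le_arith_mean2_weighted a b x y (by exact_mod_cast hab)
  rw [← ENNReal.coe_rpow_of_nonneg x (NNReal.coe_nonneg a),
    ← ENNReal.coe_rpow_of_nonneg y (NNReal.coe_nonneg b), ENNReal.ofReal_coe_nnreal,
    ENNReal.ofReal_coe_nnreal]
  exact_mod_cast this

lemma lintegral_eq_lintegral_meas_lt_of_le_one {α : Type*} [MeasurableSpace α] {μ : Measure α}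
    {f : α → ℝ≥0∞} (hf : Measurable f) (hf1 : ∀ x, f x ≤ 1) :
    ∫⁻ x, f x ∂μ = ∫⁻ t in Set.Ioo (0 : ℝ) 1, μ {x | ENNReal.ofReal t < f x} := by
  have hne : ∀ x, f x ≠ ∞ := fun x => ne_top_of_le_ne_top ENNReal.one_ne_top (hf1 x)
  have h := lintegral_eq_lintegral_meas_lt μ (f := fun x => (f x).toReal)
    (ae_of_all _ fun x => ENNReal.toReal_nonneg) hf.ennreal_toReal.aemeasurable
  simp only [ENNReal.ofReal_toReal (hne _)] at h
  rw [h, ← lintegral_indicator measurableSet_Ioi, ← lintegral_indicator measurableSet_Ioo]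
  refine lintegral_congr_ae (ae_of_all _ fun t => ?_)
  by_cases h0 : 0 < t
  · have hset : {x | t < (f x).toReal} = {x | ENNReal.ofReal t < f x} := by
      ext x
      exact (ENNReal.ofReal_lt_iff_lt_toReal h0.le (hne x)).symm
    by_cases h1 : t < 1
    · simp [h0, h1, hset]
    · have : {x | t < (f x).toReal} = ∅ := by
        ext x
        have := ENNReal.toReal_mono ENNReal.one_ne_top (hf1 x)
        simp only [ENNReal.toReal_one] at this
        simp only [Set.mem_ofPred_eq, Set.mem_empty_iff_false, iff_false, not_lt]
        linarith
      simp [this, h1]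
  · simp [h0]

lemma lintegral_add_le_of_iSup_eq_one {f g h : ℝ → ℝ≥0∞} (hf : Measurable f) (hg : Measurable g)
    (hh : Measurable h) {a b : ℝ} (ha : 0 < a) (hb : 0 < b) (hab : a + b = 1)
    (hf1 : ⨆ x, f x = 1) (hg1 : ⨆ x, g x = 1)
    (H : ∀ x y, f x ^ a * g y ^ b ≤ h (a * x + b * y)) :
    ENNReal.ofReal a * (∫⁻ x, f x) + ENNReal.ofReal b * (∫⁻ x, g x) ≤ ∫⁻ x, h x := by
  have hf1' : ∀ x, f x ≤ 1 := fun x => hf1 ▸ le_iSup f x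
  have hg1' : ∀ x, g x ≤ 1 := fun x => hg1 ▸ le_iSup g x
  refine le_trans ?_ (lintegral_mono (fun x => min_le_left (h x) 1))
  rw [lintegral_eq_lintegral_meas_lt_of_le_one hf hf1',
    lintegral_eq_lintegral_meas_lt_of_le_one hg hg1',
    lintegral_eq_lintegral_meas_lt_of_le_one (f := fun x => min (h x) 1) (hh.min measurable_const)
      (fun x => min_le_right _ _),
    ← lintegral_const_mul' _ _ ENNReal.ofReal_ne_top,
    ← lintegral_const_mul' _ _ ENNReal.ofReal_ne_top, ← lintegral_add_left']
  · refine setLIntegral_mono' measurableSet_Ioo fun t ht => ?_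
    have ht1 : ENNReal.ofReal t < 1 := by
      simpa using ht.2
    have key : ∀ c : ℝ, 0 < c → ∀ u : ℝ → ℝ≥0∞, ENNReal.ofReal c * volume {x | ENNReal.ofReal t < u x}
        = volume (c • {x | ENNReal.ofReal t < u x}) := by
      intro c hc u
      rw [Measure.addHaar_smul]
      simp [abs_of_pos hc]
    rw [key a ha, key b hb]
    obtain ⟨x₀, hx₀⟩ := lt_iSup_iff.1 (hf1 ▸ ht1)
    obtain ⟨y₀, hy₀⟩ := lt_iSup_iff.1 (hg1 ▸ ht1)
    refine MeasurableSet.volume_add_volume_le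
      ((measurableSet_lt measurable_const hf).const_smul₀ a)
      ((measurableSet_lt measurable_const hg).const_smul₀ b)
      ⟨_, Set.smul_mem_smul_set (a := a) hx₀⟩ ⟨_, Set.smul_mem_smul_set (a := b) hy₀⟩ ?_
    rintro _ ⟨x, hx, rfl⟩ _ ⟨y, hy, rfl⟩
    refine lt_min (lt_of_lt_of_le ?_ (H x y)) ht1
    have ht0 : ENNReal.ofReal t ≠ 0 := by simpa using ht.1
    calc ENNReal.ofReal t = ENNReal.ofReal t ^ a * ENNReal.ofReal t ^ b := by
          rw [← ENNReal.rpow_add _ _ ht0 ENNReal.ofReal_ne_top, hab, ENNReal.rpow_one]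
      _ < f x ^ a * g y ^ b :=
          ENNReal.mul_lt_mul (ENNReal.rpow_lt_rpow hx ha) (ENNReal.rpow_lt_rpow hy hb)
  · refine (Measurable.const_mul ?_ _).aemeasurable
    exact Antitone.measurable fun s t hst => measure_mono fun x hx =>
      lt_of_le_of_lt (ENNReal.ofReal_le_ofReal hst) hx

lemma prekopa_leindler_real_of_bounded {f g h : ℝ → ℝ≥0∞} (hf : Measurable f) (hg : Measurable g)
    (hh : Measurable h) {a b : ℝ} (ha : 0 < a) (hb : 0 < b) (hab : a + b = 1)
    (hf1 : ⨆ x, f x ≠ ∞) (hg1 : ⨆ x, g x ≠ ∞)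
    (H : ∀ x y, f x ^ a * g y ^ b ≤ h (a * x + b * y)) :
    (∫⁻ x, f x) ^ a * (∫⁻ x, g x) ^ b ≤ ∫⁻ x, h x := by
  set M := ⨆ x, f x with hM
  set N := ⨆ x, g x with hN
  by_cases hM0 : M = 0
  · have : ∀ x, f x = 0 := by simpa [hM] using hM0
    simp [this, ha]
  by_cases hN0 : N = 0
  · have : ∀ x, g x = 0 := by simpa [hN] using hN0
    simp [this, hb]
  have hc0 : M ^ a * N ^ b ≠ 0 := by
    simp [hM0, hN0, ENNReal.rpow_eq_zero_iff, ha.not_gt, hb.not_gt]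
  have hct : M ^ a * N ^ b ≠ ∞ := ENNReal.mul_ne_top (ENNReal.rpow_ne_top_of_nonneg ha.le hf1)
    (ENNReal.rpow_ne_top_of_nonneg hb.le hg1)
  have hinv : (M ^ a * N ^ b)⁻¹ = M⁻¹ ^ a * N⁻¹ ^ b := by
    rw [ENNReal.mul_inv (Or.inr (ENNReal.rpow_ne_top_of_nonneg hb.le hg1))
      (Or.inl (ENNReal.rpow_ne_top_of_nonneg ha.le hf1)), ENNReal.inv_rpow, ENNReal.inv_rpow]
  have key := lintegral_add_le_of_iSup_eq_one (f := fun x => M⁻¹ * f x) (g := fun x => N⁻¹ * g x)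
    (h := fun x => (M ^ a * N ^ b)⁻¹ * h x) (hf.const_mul _) (hg.const_mul _) (hh.const_mul _)
    ha hb hab (by rw [← ENNReal.mul_iSup, ← hM, ENNReal.inv_mul_cancel hM0 hf1])
    (by rw [← ENNReal.mul_iSup, ← hN, ENNReal.inv_mul_cancel hN0 hg1]) (by
      intro x y
      rw [ENNReal.mul_rpow_of_nonneg _ _ ha.le, ENNReal.mul_rpow_of_nonneg _ _ hb.le,
        mul_mul_mul_comm, ← hinv]
      gcongr
      exact H x y)
  have key2 := (ENNReal.rpow_mul_rpow_le_add ha hb hab _ _).trans key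
  rw [lintegral_const_mul _ hf, lintegral_const_mul _ hg, lintegral_const_mul _ hh,
    ENNReal.mul_rpow_of_nonneg _ _ ha.le, ENNReal.mul_rpow_of_nonneg _ _ hb.le,
    mul_mul_mul_comm, ← hinv] at key2
  exact (ENNReal.mul_le_mul_iff_right (ENNReal.inv_ne_zero.2 hct) (ENNReal.inv_ne_top.2 hc0)).1 key2

lemma tendsto_lintegral_min_natCast {α : Type*} [MeasurableSpace α] {μ : Measure α}
    {f : α → ℝ≥0∞} (hf : Measurable f) :
    Tendsto (fun k : ℕ => ∫⁻ x, min (f x) k ∂μ) atTop (𝓝 (∫⁻ x, f x ∂μ)) := by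
  refine lintegral_tendsto_of_tendsto_of_monotone
    (fun k => (hf.min measurable_const).aemeasurable)
    (ae_of_all _ fun x i j hij => by dsimp only; gcongr) (ae_of_all _ fun x => ?_)
  simpa using (tendsto_const_nhds (x := f x)).min ENNReal.tendsto_nat_nhds_top

/-- The Prékopa–Leindler inequality on the real line. -/
lemma prekopa_leindler_real {f g h : ℝ → ℝ≥0∞} (hf : Measurable f) (hg : Measurable g)
    (hh : Measurable h) {a b : ℝ} (ha : 0 < a) (hb : 0 < b) (hab : a + b = 1)
    (H : ∀ x y, f x ^ a * g y ^ b ≤ h (a * x + b * y)) :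
    (∫⁻ x, f x) ^ a * (∫⁻ x, g x) ^ b ≤ ∫⁻ x, h x := by
  by_cases hf0 : ∫⁻ x, f x = 0
  · simp [hf0, ha]
  by_cases hg0 : ∫⁻ x, g x = 0
  · simp [hg0, hb]
  have hlim := ENNReal.Tendsto.mul
    ((ENNReal.continuous_rpow_const (y := a)).tendsto _ |>.comp
      (tendsto_lintegral_min_natCast (μ := volume) hf)) (b := (∫⁻ x, g x) ^ b)
    (Or.inl (by simp [ENNReal.rpow_eq_zero_iff, hf0, ha.not_gt]))
    ((ENNReal.continuous_rpow_const (y := b)).tendsto _ |>.comp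
      (tendsto_lintegral_min_natCast (μ := volume) hg))
    (Or.inl (by simp [ENNReal.rpow_eq_zero_iff, hg0, hb.not_gt]))
  refine le_of_tendsto' hlim fun k => ?_
  have hbd : ∀ u : ℝ → ℝ≥0∞, ⨆ x, min (u x) (k : ℝ≥0∞) ≠ ∞ := fun u =>
    ne_top_of_le_ne_top (ENNReal.natCast_ne_top k) (iSup_le fun x => min_le_right _ _)
  refine prekopa_leindler_real_of_bounded (hf.min measurable_const) (hg.min measurable_const) hh
    ha hb hab (hbd f) (hbd g) fun x y => le_trans ?_ (H x y)
  gcongr <;> exact min_le_left _ _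

lemma lintegral_fin_succ {n : ℕ} {f : (Fin (n + 1) → ℝ) → ℝ≥0∞} (hf : Measurable f) :
    ∫⁻ x, f x = ∫⁻ s : ℝ, ∫⁻ x : Fin n → ℝ, f (Fin.cons s x) := by
  rw [← (volume_preserving_piFinSuccAbove (fun _ : Fin (n + 1) => ℝ) 0).symm.lintegral_comp hf,
    Measure.volume_eq_prod, lintegral_prod]
  · simp [MeasurableEquiv.piFinSuccAbove, Fin.consEquiv]
  · exact (hf.comp (MeasurableEquiv.measurable _)).aemeasurable

lemma measurable_fin_cons {n : ℕ} :
    Measurable fun p : ℝ × (Fin n → ℝ) => (Fin.cons p.1 p.2 : Fin (n + 1) → ℝ) := by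
  refine measurable_pi_iff.2 fun i => ?_
  refine Fin.cases ?_ (fun j => ?_) i
  · simpa using measurable_fst
  · simpa [Function.comp_def] using (measurable_pi_apply j).comp measurable_snd

/-- The Prékopa–Leindler inequality. -/
theorem prekopa_leindler {n : ℕ} {f g h : (Fin n → ℝ) → ℝ≥0∞} (hf : Measurable f)
    (hg : Measurable g) (hh : Measurable h) {a b : ℝ} (ha : 0 < a) (hb : 0 < b) (hab : a + b = 1)
    (H : ∀ x y, f x ^ a * g y ^ b ≤ h (a • x + b • y)) :
    (∫⁻ x, f x) ^ a * (∫⁻ x, g x) ^ b ≤ ∫⁻ x, h x := by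
  induction n with
  | zero =>
    simp only [volume_pi, Measure.pi_of_empty _ 0, lintegral_dirac]
    simpa using H 0 0
  | succ n ih =>
    rw [lintegral_fin_succ hf, lintegral_fin_succ hg, lintegral_fin_succ hh]
    have meas : ∀ {u : (Fin (n + 1) → ℝ) → ℝ≥0∞}, Measurable u →
        Measurable fun s : ℝ => ∫⁻ x : Fin n → ℝ, u (Fin.cons s x) := fun hu =>
      (hu.comp measurable_fin_cons).lintegral_prod_right'
    have meas' : ∀ {u : (Fin (n + 1) → ℝ) → ℝ≥0∞}, Measurable u → ∀ s : ℝ,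
        Measurable fun x : Fin n → ℝ => u (Fin.cons s x) := fun hu s =>
      (hu.comp measurable_fin_cons).comp measurable_prodMk_left
    refine prekopa_leindler_real (meas hf) (meas hg) (meas hh) ha hb hab fun s t => ?_
    refine ih (meas' hf s) (meas' hg t) (meas' hh _) fun x y => ?_
    refine (H _ _).trans (le_of_eq ?_)
    congr 1
    ext i
    refine Fin.cases ?_ (fun j => ?_) i <;> simp

end PrekopaLeindler

section BrunnMinkowski

open scoped Pointwise

/-- The Brunn–Minkowski inequality `|A + B| ≥ (|A|^{1/n} + |B|^{1/n})^n`. -/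
theorem brunn_minkowski_pi {n : ℕ} {A B C : Set (Fin n → ℝ)} (hA : MeasurableSet A)
    (hB : MeasurableSet B) (hC : MeasurableSet C) {α β : ℝ} (hα : 0 < α) (hβ : 0 < β)
    (hAα : volume A = ENNReal.ofReal (α ^ n)) (hBβ : volume B = ENNReal.ofReal (β ^ n))
    (h : ∀ x ∈ A, ∀ y ∈ B, x + y ∈ C) :
    ENNReal.ofReal ((α + β) ^ n) ≤ volume C := by
  have hs : 0 < α + β := add_pos hα hβ
  obtain ⟨a, ha⟩ : ∃ a, a = α / (α + β) := ⟨_, rfl⟩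
  obtain ⟨b, hb⟩ : ∃ b, b = β / (α + β) := ⟨_, rfl⟩
  have ha0 : 0 < a := by rw [ha]; positivity
  have hb0 : 0 < b := by rw [hb]; positivity
  have hab : a + b = 1 := by rw [ha, hb]; field_simp
  have hA' : MeasurableSet (a⁻¹ • A) := hA.const_smul₀ _
  have hB' : MeasurableSet (b⁻¹ • B) := hB.const_smul₀ _
  have key := prekopa_leindler (f := (a⁻¹ • A).indicator 1) (g := (b⁻¹ • B).indicator 1)
    (h := C.indicator 1) (measurable_one.indicator hA') (measurable_one.indicator hB')
    (measurable_one.indicator hC) ha0 hb0 hab (by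
      intro x y
      by_cases hx : x ∈ a⁻¹ • A
      · by_cases hy : y ∈ b⁻¹ • B
        · have : a • x + b • y ∈ C :=
            h _ ((Set.mem_inv_smul_set_iff₀ ha0.ne' _ _).1 hx) _
              ((Set.mem_inv_smul_set_iff₀ hb0.ne' _ _).1 hy)
          simp [hx, hy, this]
        · simp [hy, hb0]
      · simp [hx, ha0])
  rw [lintegral_indicator_one hA', lintegral_indicator_one hB', lintegral_indicator_one hC,
    Measure.addHaar_smul, Measure.addHaar_smul, hAα, hBβ, ← ENNReal.ofReal_mul (abs_nonneg _),
    ← ENNReal.ofReal_mul (abs_nonneg _)] at key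
  have h1 : |a⁻¹ ^ Module.finrank ℝ (Fin n → ℝ)| * α ^ n = (α + β) ^ n := by
    rw [Module.finrank_fin_fun, abs_of_pos (by positivity), ← mul_pow, ha]
    congr 1
    field_simp
  have h2 : |b⁻¹ ^ Module.finrank ℝ (Fin n → ℝ)| * β ^ n = (α + β) ^ n := by
    rw [Module.finrank_fin_fun, abs_of_pos (by positivity), ← mul_pow, hb]
    congr 1
    field_simp
  rwa [h1, h2, ← ENNReal.rpow_add _ _ (by simpa using pow_pos hs n) ENNReal.ofReal_ne_top, hab,
    ENNReal.rpow_one] at key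

/-- The first-order consequence of the Brunn–Minkowski inequality for the outer parallel sets of
`A`, where `r ^ n` is the volume of the unit ball. -/
lemma volume_add_le_volume_of_add_ball_subset {n : ℕ} (hn : 2 ≤ n)
    {A C : Set (EuclideanSpace ℝ (Fin n))} (hA : MeasurableSet A) (hC : MeasurableSet C)
    (hAtop : volume A ≠ ∞) {r ε : ℝ} (hr : 0 < r)
    (hball : volume (Metric.ball (0 : EuclideanSpace ℝ (Fin n)) 1) = ENNReal.ofReal (r ^ n))
    (hε : 0 < ε) (h : ∀ x ∈ A, ∀ z ∈ Metric.ball (0 : EuclideanSpace ℝ (Fin n)) ε, x + z ∈ C) :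
    volume A + ENNReal.ofReal (n * r * ε) * volume A ^ (((n : ℝ) - 1) / n) ≤ volume C := by
  have hn0 : n ≠ 0 := by omega
  have hnr : (2 : ℝ) ≤ n := by exact_mod_cast hn
  by_cases hA0 : volume A = 0
  · rw [hA0, ENNReal.zero_rpow_of_pos (div_pos (by linarith) (by linarith))]
    simp
  obtain ⟨α, hα⟩ : ∃ α, α = (volume A).toReal ^ ((n : ℝ)⁻¹) := ⟨_, rfl⟩
  have hα0 : 0 < α := hα ▸ Real.rpow_pos_of_pos (ENNReal.toReal_pos hA0 hAtop) _
  have hαn : volume A = ENNReal.ofReal (α ^ n) := by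
    rw [hα, Real.rpow_inv_natCast_pow ENNReal.toReal_nonneg hn0, ENNReal.ofReal_toReal hAtop]
  have hballε : volume (Metric.ball (0 : EuclideanSpace ℝ (Fin n)) ε)
      = ENNReal.ofReal ((ε * r) ^ n) := by
    rw [Measure.addHaar_ball_of_pos _ _ hε, hball, finrank_euclideanSpace_fin,
      ← ENNReal.ofReal_mul (by positivity), mul_pow]
  have mp := PiLp.volume_preserving_toLp (Fin n)
  have key := brunn_minkowski_pi (A := WithLp.toLp 2 ⁻¹' A)
    (B := WithLp.toLp 2 ⁻¹' Metric.ball (0 : EuclideanSpace ℝ (Fin n)) ε)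
    (C := WithLp.toLp 2 ⁻¹' C) (mp.measurable hA) (mp.measurable measurableSet_ball)
    (mp.measurable hC) hα0 (mul_pos hε hr)
    (by rw [mp.measure_preimage hA.nullMeasurableSet, hαn])
    (by rw [mp.measure_preimage measurableSet_ball.nullMeasurableSet, hballε])
    (fun x hx y hy => h _ hx _ hy)
  rw [mp.measure_preimage hC.nullMeasurableSet] at key
  refine le_trans ?_ key
  have hpow : volume A ^ (((n : ℝ) - 1) / n) = ENNReal.ofReal (α ^ (n - 1)) := by
    rw [hαn, ENNReal.ofReal_rpow_of_pos (by positivity), ← Real.rpow_natCast α n,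
      ← Real.rpow_mul hα0.le, mul_div_cancel₀ _ (by positivity), ← Real.rpow_natCast α (n - 1),
      Nat.cast_sub (by omega), Nat.cast_one]
  rw [hpow, hαn, ← ENNReal.ofReal_mul (by positivity), ← ENNReal.ofReal_add (by positivity)
    (by positivity)]
  refine ENNReal.ofReal_le_ofReal ?_
  have hb := one_add_mul_le_pow (a := ε * r / α)
    (le_trans (by norm_num) (div_pos (mul_pos hε hr) hα0).le) n
  calc α ^ n + n * r * ε * α ^ (n - 1) = α ^ n * (1 + n * (ε * r / α)) := by
        obtain ⟨m, rfl⟩ : ∃ m, n = m + 1 := ⟨n - 1, by omega⟩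
        simp only [Nat.add_sub_cancel]
        field_simp
        ring
    _ ≤ α ^ n * (1 + ε * r / α) ^ n := by gcongr
    _ = (α + ε * r) ^ n := by
        rw [← mul_pow]
        congr 1
        field_simp

end BrunnMinkowski

section Sobolev

lemma measurable_measure_lt {α : Type*} [MeasurableSpace α] (μ : Measure α) (f : α → ℝ) :
    Measurable fun t : ℝ => μ {x | t < f x} :=
  Antitone.measurable fun _ _ hst => measure_mono fun _ hx => lt_of_le_of_lt hst hx

/-- The `L^p`-norm of a function is at most the integral of the `L^p`-norms of the indicators of
its superlevel sets. -/
lemma lintegral_rpow_le_lintegral_measure_lt_rpow {α : Type*} [MeasurableSpace α] {μ : Measure α}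
    [SFinite μ] {f : α → ℝ} (hf : Measurable f) {p q : ℝ}
    (hpq : p.HolderConjugate q) (hfin : ∫⁻ x, ENNReal.ofReal (f x) ^ p ∂μ ≠ ∞) :
    (∫⁻ x, ENNReal.ofReal (f x) ^ p ∂μ) ^ (1 / p) ≤
      ∫⁻ t in Set.Ioi (0 : ℝ), μ {x | t < f x} ^ (1 / p) := by
  set I := ∫⁻ x, ENNReal.ofReal (f x) ^ p ∂μ with hI
  set J := ∫⁻ t in Set.Ioi (0 : ℝ), μ {x | t < f x} ^ (1 / p) with hJ
  by_cases hI0 : I = 0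
  · rw [hI0, ENNReal.zero_rpow_of_pos (one_div_pos.2 hpq.pos)]
    exact zero_le
  have hp1 : 0 < p - 1 := by linarith [hpq.lt]
  have hg : Measurable fun x => ENNReal.ofReal (f x) ^ (p - 1) := hf.ennreal_ofReal.pow_const _
  have hmain : I ≤ I ^ (1 / q) * J := by
    calc I = ∫⁻ x, (∫⁻ t in Set.Ioi (0 : ℝ),
          ENNReal.ofReal (f x) ^ (p - 1) * {y : α | t < f y}.indicator 1 x) ∂μ := by
          refine lintegral_congr fun x => ?_
          have h1 : ENNReal.ofReal (f x)
              = ∫⁻ t in Set.Ioi (0 : ℝ), {y : α | t < f y}.indicator (1 : α → ℝ≥0∞) x := by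
            have : (fun t : ℝ => {y : α | t < f y}.indicator (1 : α → ℝ≥0∞) x)
                = (Set.Iio (f x)).indicator 1 := by
              ext t
              simp [Set.indicator_apply]
            rw [this, lintegral_indicator_one measurableSet_Iio,
              Measure.restrict_apply measurableSet_Iio, Set.Iio_inter_Ioi, Real.volume_Ioo,
              sub_zero]
          rw [lintegral_const_mul' _ _ (ENNReal.rpow_ne_top_of_nonneg hp1.le
            ENNReal.ofReal_ne_top), ← h1]
          by_cases h0 : ENNReal.ofReal (f x) = 0
          · simp [h0, hpq.pos]
          · conv_rhs => rw [← ENNReal.rpow_one (ENNReal.ofReal (f x)), ← ENNReal.rpow_mul, one_mul,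
              ← ENNReal.rpow_add _ _ h0 ENNReal.ofReal_ne_top]
            congr 1
            ring
      _ = ∫⁻ t in Set.Ioi (0 : ℝ), ∫⁻ x,
          ENNReal.ofReal (f x) ^ (p - 1) * {y : α | t < f y}.indicator 1 x ∂μ := by
          refine lintegral_lintegral_swap ?_
          refine ((hg.comp measurable_fst).mul ?_).aemeasurable
          have hset : MeasurableSet {z : α × ℝ | z.2 < f z.1} :=
            measurableSet_lt measurable_snd (hf.comp measurable_fst)
          exact (measurable_one.indicator hset :
            Measurable ({z : α × ℝ | z.2 < f z.1}.indicator (1 : α × ℝ → ℝ≥0∞)))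
      _ ≤ ∫⁻ t in Set.Ioi (0 : ℝ), I ^ (1 / q) * μ {x | t < f x} ^ (1 / p) := by
          refine lintegral_mono fun t => ?_
          have hset : MeasurableSet {y : α | t < f y} := measurableSet_lt measurable_const hf
          refine (ENNReal.lintegral_mul_le_Lp_mul_Lq μ hpq.symm hg.aemeasurable
            (measurable_one.indicator hset).aemeasurable).trans (le_of_eq ?_)
          congr 2
          · refine lintegral_congr fun x => ?_
            rw [← ENNReal.rpow_mul, hpq.sub_one_mul_conj]
          · rw [← lintegral_indicator_one hset]
            refine lintegral_congr fun x => ?_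
            by_cases hx : t < f x <;> simp [hx, hpq.pos]
      _ = I ^ (1 / q) * J := lintegral_const_mul' _ _
          (ENNReal.rpow_ne_top_of_nonneg (one_div_pos.2 hpq.symm.pos).le hfin)
  have hIq0 : I ^ (1 / q) ≠ 0 := by
    simp [ENNReal.rpow_eq_zero_iff, hI0, hfin]
  have hIqt : I ^ (1 / q) ≠ ∞ := ENNReal.rpow_ne_top_of_nonneg (one_div_pos.2 hpq.symm.pos).le hfin
  refine (ENNReal.mul_le_mul_iff_right hIq0 hIqt).1 (le_trans (le_of_eq ?_) hmain)
  rw [← ENNReal.rpow_add _ _ hI0 hfin, one_div, one_div, add_comm, hpq.inv_add_inv_eq_one,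
    ENNReal.rpow_one]

lemma abs_le_abs_add_mul_of_dist_fderiv_lt {E : Type*} [NormedAddCommGroup E] [NormedSpace ℝ E]
    {f : E → ℝ} (hf : Differentiable ℝ f) {x z : E} {δ ε : ℝ} (hz : ‖z‖ < ε)
    (h : ∀ w, dist w (x + z) < ε → dist (fderiv ℝ f w) (fderiv ℝ f (x + z)) < δ) :
    |f x| ≤ |f (x + z)| + ε * (‖fderiv ℝ f (x + z)‖ + δ) := by
  have hε : 0 < ε := (norm_nonneg z).trans_lt hz
  have hδ : 0 < δ := dist_nonneg.trans_lt (h (x + z) (by simpa using hε))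
  have key := (convex_ball (x + z) ε).norm_image_sub_le_of_norm_fderiv_le (𝕜 := ℝ) (f := f)
    (C := ‖fderiv ℝ f (x + z)‖ + δ) (x := x + z) (y := x) (fun w _ => hf w) (fun w hw => by
      have h1 := h w hw
      rw [dist_eq_norm] at h1
      have h2 := norm_le_norm_add_norm_sub' (fderiv ℝ f w) (fderiv ℝ f (x + z))
      linarith) (by simpa using hε) (by simpa [Metric.mem_ball, dist_eq_norm] using hz)
  have h3 : ‖x - (x + z)‖ = ‖z‖ := by simp
  rw [h3, Real.norm_eq_abs] at key
  have h4 : |f x| - |f (x + z)| ≤ |f x - f (x + z)| := abs_sub_abs_le_abs_sub _ _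
  have h5 : (‖fderiv ℝ f (x + z)‖ + δ) * ‖z‖ ≤ (‖fderiv ℝ f (x + z)‖ + δ) * ε := by gcongr
  linarith

/-- The isoperimetric inequality integrated over the superlevel sets of `|f|`, with an error
term. -/
lemma lintegral_volume_lt_rpow_le_add {n : ℕ} (hn : 2 ≤ n) {f : EuclideanSpace ℝ (Fin n) → ℝ}
    (hf : ContDiff ℝ 1 f) (hsupp : HasCompactSupport f) {r : ℝ} (hr : 0 < r)
    (hball : volume (Metric.ball (0 : EuclideanSpace ℝ (Fin n)) 1) = ENNReal.ofReal (r ^ n))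
    {δ : ℝ} (hδ : 0 < δ) :
    ENNReal.ofReal (n * r) *
        ∫⁻ t in Set.Ioi (0 : ℝ), volume {x | t < |f x|} ^ (((n : ℝ) - 1) / n) ≤
      (∫⁻ x, ENNReal.ofReal ‖fderiv ℝ f x‖) +
        ENNReal.ofReal δ * volume (Metric.cthickening 1 (tsupport f)) := by
  set K := Metric.cthickening 1 (tsupport f) with hK
  have hKmeas : MeasurableSet K := Metric.isClosed_cthickening.measurableSet
  have hDf : Continuous (fderiv ℝ f) := hf.continuous_fderiv (by norm_num)
  have hfm : Measurable fun x => |f x| := hf.continuous.abs.measurable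
  obtain ⟨η, hη, hη'⟩ := Metric.uniformContinuous_iff.1
    (hDf.uniformContinuous_of_tendsto_cocompact
      (hsupp.fderiv (𝕜 := ℝ)).is_zero_at_infty) δ hδ
  obtain ⟨ε, hε⟩ : ∃ ε, ε = min η 1 := ⟨_, rfl⟩
  have hε0 : 0 < ε := hε ▸ lt_min hη one_pos
  have hε0' : ENNReal.ofReal ε ≠ 0 := by simpa using hε0
  set G : EuclideanSpace ℝ (Fin n) → ℝ := fun x => ‖fderiv ℝ f x‖ + K.indicator (fun _ => δ) x
    with hG
  have hG0 : ∀ x, 0 ≤ G x := fun x =>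
    add_nonneg (norm_nonneg _) (Set.indicator_nonneg (fun _ _ => hδ.le) x)
  have hGm : Measurable G := hDf.norm.measurable.add (measurable_const.indicator hKmeas)
  set h : EuclideanSpace ℝ (Fin n) → ℝ := fun x => |f x| + ε * G x with hh
  have hhm : Measurable h := hfm.add (hGm.const_mul _)
  have hGint : ∫⁻ x, ENNReal.ofReal (G x) =
      (∫⁻ x, ENNReal.ofReal ‖fderiv ℝ f x‖) + ENNReal.ofReal δ * volume K := by
    rw [← lintegral_indicator_const hKmeas, ← lintegral_add_left hDf.norm.measurable.ennreal_ofReal]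
    refine lintegral_congr fun x => ?_
    rw [hG, ENNReal.ofReal_add (norm_nonneg _) (Set.indicator_nonneg (fun _ _ => hδ.le) x)]
    by_cases hx : x ∈ K <;> simp [hx]
  have hhint : ∫⁻ x, ENNReal.ofReal (h x) =
      (∫⁻ x, ENNReal.ofReal |f x|) + ENNReal.ofReal ε * ∫⁻ x, ENNReal.ofReal (G x) := by
    rw [← lintegral_const_mul' _ _ ENNReal.ofReal_ne_top,
      ← lintegral_add_left hfm.ennreal_ofReal]
    refine lintegral_congr fun x => ?_
    rw [hh, ENNReal.ofReal_add (abs_nonneg _) (mul_nonneg hε0.le (hG0 x)),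
      ENNReal.ofReal_mul hε0.le]
  have hlevel : ∀ t ∈ Set.Ioi (0 : ℝ), volume {x | t < |f x|} +
      ENNReal.ofReal (n * r * ε) * volume {x | t < |f x|} ^ (((n : ℝ) - 1) / n) ≤
        volume {x | t < h x} := by
    intro t ht
    have hsub : {x | t < |f x|} ⊆ tsupport f := fun x hx =>
      subset_tsupport f fun h0 => by
        have : t < |f x| := hx
        rw [h0, abs_zero] at this
        exact lt_asymm ht this
    refine volume_add_le_volume_of_add_ball_subset hn (measurableSet_lt measurable_const hfm)
      (measurableSet_lt measurable_const hhm)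
      (ne_top_of_le_ne_top hsupp.isCompact.measure_lt_top.ne (measure_mono hsub)) hr hball hε0 ?_
    intro x hx z hz
    have hz' : ‖z‖ < ε := by simpa using hz
    have hxK : x + z ∈ K := by
      refine Metric.mem_cthickening_of_dist_le (x + z) x 1 _ (hsub hx) ?_
      have : ε ≤ 1 := hε ▸ min_le_right _ _
      simpa [dist_eq_norm] using hz'.le.trans this
    have key := abs_le_abs_add_mul_of_dist_fderiv_lt (hf.differentiable (by norm_num)) (δ := δ)
      (x := x) hz' fun w hw => hη' (hw.trans_le (hε ▸ min_le_left _ _))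
    refine lt_of_lt_of_le (show t < |f x| from hx) ?_
    simpa [hh, hG, hxK] using key
  have hsum : (∫⁻ x, ENNReal.ofReal |f x|) + ENNReal.ofReal (n * r * ε) *
      (∫⁻ t in Set.Ioi (0 : ℝ), volume {x | t < |f x|} ^ (((n : ℝ) - 1) / n)) ≤
        ∫⁻ x, ENNReal.ofReal (h x) := by
    rw [lintegral_eq_lintegral_meas_lt volume (ae_of_all _ fun x => abs_nonneg _) hfm.aemeasurable,
      lintegral_eq_lintegral_meas_lt volume (ae_of_all _ fun x =>
        add_nonneg (abs_nonneg _) (mul_nonneg hε0.le (hG0 x))) hhm.aemeasurable,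
      ← lintegral_const_mul' _ _ ENNReal.ofReal_ne_top,
      ← lintegral_add_left (measurable_measure_lt volume fun x => |f x|)]
    exact setLIntegral_mono' measurableSet_Ioi hlevel
  have hfint : ∫⁻ x, ENNReal.ofReal |f x| ≠ ∞ :=
    (hf.continuous.integrable_of_hasCompactSupport hsupp).abs.lintegral_lt_top.ne
  rw [hhint, ENNReal.add_le_add_iff_left hfint, hGint, mul_comm ((n : ℝ) * r),
    ENNReal.ofReal_mul hε0.le, mul_assoc,
    ENNReal.mul_le_mul_iff_right hε0' ENNReal.ofReal_ne_top] at hsum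
  exact hsum

lemma lintegral_volume_lt_rpow_le {n : ℕ} (hn : 2 ≤ n) {f : EuclideanSpace ℝ (Fin n) → ℝ}
    (hf : ContDiff ℝ 1 f) (hsupp : HasCompactSupport f) {r : ℝ} (hr : 0 < r)
    (hball : volume (Metric.ball (0 : EuclideanSpace ℝ (Fin n)) 1) = ENNReal.ofReal (r ^ n)) :
    ENNReal.ofReal (n * r) *
        ∫⁻ t in Set.Ioi (0 : ℝ), volume {x | t < |f x|} ^ (((n : ℝ) - 1) / n) ≤
      ∫⁻ x, ENNReal.ofReal ‖fderiv ℝ f x‖ := by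
  have hV : volume (Metric.cthickening 1 (tsupport f)) ≠ ∞ :=
    hsupp.isCompact.cthickening.measure_lt_top.ne
  have hlim : Tendsto (fun δ : ℝ => (∫⁻ x, ENNReal.ofReal ‖fderiv ℝ f x‖) +
      ENNReal.ofReal δ * volume (Metric.cthickening 1 (tsupport f))) (𝓝[>] 0)
      (𝓝 (∫⁻ x, ENNReal.ofReal ‖fderiv ℝ f x‖)) := by
    have h0 : Tendsto (fun δ : ℝ => ENNReal.ofReal δ) (𝓝[>] 0) (𝓝 0) := by
      have := (ENNReal.continuous_ofReal.tendsto 0).mono_left (nhdsWithin_le_nhds (s := Set.Ioi 0))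
      simpa using this
    simpa using tendsto_const_nhds.add (ENNReal.Tendsto.mul_const h0 (Or.inr hV))
  refine ge_of_tendsto hlim ?_
  filter_upwards [self_mem_nhdsWithin] with δ hδ
  exact lintegral_volume_lt_rpow_le_add hn hf hsupp hr hball hδ

lemma ballVol_pos (n : ℕ) : 0 < ballVol n :=
  div_pos (Real.rpow_pos_of_pos Real.pi_pos _) (Real.Gamma_pos_of_pos (by positivity))

lemma volume_ball_zero_one_eq_ballVol {n : ℕ} (hn : n ≠ 0) :
    volume (Metric.ball (0 : EuclideanSpace ℝ (Fin n)) 1) = ENNReal.ofReal (ballVol n) := by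
  have : Nonempty (Fin n) := Fin.pos_iff_nonempty.1 (Nat.pos_of_ne_zero hn)
  rw [EuclideanSpace.volume_ball, ballVol, Fintype.card_fin, Real.sqrt_eq_rpow,
    ← Real.rpow_natCast, ← Real.rpow_mul Real.pi_pos.le, ENNReal.ofReal_one, one_pow, one_mul,
    one_div_mul_eq_div]

end Sobolev

/-- Sharp `L^1`-Sobolev inequality in `ℝ^n` (Euclidean case of Theorem 1.1 with `p = 1`). -/
theorem sharp_L1_sobolev_euclidean (n : ℕ) (hn : 2 ≤ n)
    (f : EuclideanSpace ℝ (Fin n) → ℝ) (hf : ContDiff ℝ (⊤ : ℕ∞) f)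
    (hsupp : HasCompactSupport f) :
    (∫ x : EuclideanSpace ℝ (Fin n), |f x| ^ ((n : ℝ) / ((n : ℝ) - 1))) ^ (((n : ℝ) - 1) / n) ≤
      (n : ℝ)⁻¹ * ballVol n ^ (-(1 : ℝ) / n) *
        ∫ x : EuclideanSpace ℝ (Fin n), ‖fderiv ℝ f x‖ := by
  have hn0 : n ≠ 0 := by omega
  have hnr : (2 : ℝ) ≤ n := by exact_mod_cast hn
  have hf1 : ContDiff ℝ 1 f := hf.of_le (by exact_mod_cast le_top)
  have hp : 0 < (n : ℝ) / ((n : ℝ) - 1) := div_pos (by linarith) (by linarith)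
  have hpq : ((n : ℝ) / ((n : ℝ) - 1)).HolderConjugate n :=
    (Real.HolderConjugate.conjExponent (by linarith : (1 : ℝ) < n)).symm
  have hpinv : ((n : ℝ) - 1) / n = 1 / ((n : ℝ) / ((n : ℝ) - 1)) := by rw [one_div_div]
  obtain ⟨r, hr⟩ : ∃ r, r = ballVol n ^ ((n : ℝ)⁻¹) := ⟨_, rfl⟩
  have hr0 : 0 < r := hr ▸ Real.rpow_pos_of_pos (ballVol_pos n) _
  have hball : volume (Metric.ball (0 : EuclideanSpace ℝ (Fin n)) 1) = ENNReal.ofReal (r ^ n) := by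
    rw [volume_ball_zero_one_eq_ballVol hn0, hr, Real.rpow_inv_natCast_pow (ballVol_pos n).le hn0]
  have hIint : Integrable fun x => |f x| ^ ((n : ℝ) / ((n : ℝ) - 1)) := by
    refine (hf.continuous.abs.rpow_const fun x => Or.inr hp.le).integrable_of_hasCompactSupport ?_
    exact hsupp.comp_left (g := fun y : ℝ => |y| ^ ((n : ℝ) / ((n : ℝ) - 1)))
      (by simp [Real.zero_rpow hp.ne'])
  have hDint : Integrable fun x => ‖fderiv ℝ f x‖ :=
    (((hf1.continuous_fderiv (by norm_num)).integrable_of_hasCompactSupport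
      (hsupp.fderiv (𝕜 := ℝ)))).norm
  have hI0 : 0 ≤ ∫ x, |f x| ^ ((n : ℝ) / ((n : ℝ) - 1)) := integral_nonneg fun x => by positivity
  have hI : ENNReal.ofReal (∫ x, |f x| ^ ((n : ℝ) / ((n : ℝ) - 1))) =
      ∫⁻ x, ENNReal.ofReal |f x| ^ ((n : ℝ) / ((n : ℝ) - 1)) := by
    rw [ofReal_integral_eq_lintegral_ofReal hIint (ae_of_all _ fun x => by positivity)]
    exact lintegral_congr fun x => (ENNReal.ofReal_rpow_of_nonneg (abs_nonneg _) hp.le).symm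
  have hD := ofReal_integral_eq_lintegral_ofReal hDint (ae_of_all _ fun x => norm_nonneg _)
  have key := lintegral_rpow_le_lintegral_measure_lt_rpow (μ := volume)
    hf.continuous.abs.measurable hpq (hI ▸ ENNReal.ofReal_ne_top)
  have key2 := lintegral_volume_lt_rpow_le hn hf1 hsupp hr0 hball
  rw [← hpinv, ← hI, ENNReal.ofReal_rpow_of_nonneg hI0 (by rw [hpinv]; positivity)] at key
  have key3 := (mul_le_mul_right key (ENNReal.ofReal (n * r))).trans key2
  rw [← hD, ← ENNReal.ofReal_mul (by positivity), ENNReal.ofReal_le_ofReal_iff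
    (integral_nonneg fun x => norm_nonneg _)] at key3
  have hc : (n : ℝ)⁻¹ * ballVol n ^ (-(1 : ℝ) / n) = (n * r)⁻¹ := by
    rw [hr, mul_inv, ← Real.rpow_neg (ballVol_pos n).le, neg_div, one_div]
  rw [hc, inv_mul_eq_div, le_div_iff₀' (by positivity)]
  exact key3
end

section
/- Let n ≥ 2 be an integer and p > 1 a real number. If C > 0 is a constant such that ∫_{ℝ^n} |f|^p log |f|^p dx ≤ (n/p) log ( C ∫_{ℝ^n} |∇f|^p dx ) holds for every smooth compactly supported function f : ℝ^n → ℝ with ∫_{ℝ^n} |f|^p dx = 1, then C ≥ L(n,p). -/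
open Real MeasureTheory Filter Topology

/-- The sharp constant `L(n,p)` of the `L^p`-logarithmic Sobolev inequality. -/
noncomputable def Lconst (n : ℕ) (p : ℝ) : ℝ :=
  (p / n) * ((p - 1) / Real.exp 1) ^ (p - 1) *
    (ballVol n * Real.Gamma ((n : ℝ) / (p / (p - 1)) + 1)) ^ (-(p / (n : ℝ)))

section Radial

variable {E : Type*} [NormedAddCommGroup E] [InnerProductSpace ℝ E] [FiniteDimensional ℝ E]
  [Nontrivial E]

lemma pow_finrank_sub_one_mul_rpow {y : ℝ} (hy : 0 < y) (s : ℝ) :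
    y ^ (Module.finrank ℝ E - 1) * y ^ s = y ^ ((Module.finrank ℝ E : ℝ) + s - 1) := by
  rw [← rpow_natCast, ← rpow_add hy, Nat.cast_sub Module.finrank_pos]
  congr 1
  push_cast
  ring

variable [MeasurableSpace E] [BorelSpace E]

lemma integrable_norm_rpow_mul_exp_neg_mul_rpow {s b q : ℝ} (hs : 0 ≤ s) (hb : 0 < b)
    (hq : 0 < q) (μ : Measure E) [μ.IsAddHaarMeasure] :
    Integrable (fun x : E => ‖x‖ ^ s * exp (-b * ‖x‖ ^ q)) μ := by
  refine (integrable_fun_norm_addHaar μ (f := fun r => r ^ s * exp (-b * r ^ q))).2 ?_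
  have hd : (0 : ℝ) < Module.finrank ℝ E := by exact_mod_cast Module.finrank_pos
  refine (integrableOn_rpow_mul_exp_neg_mul_rpow
    (s := (Module.finrank ℝ E : ℝ) + s - 1) (by linarith) hq hb).congr_fun ?_ measurableSet_Ioi
  intro y hy
  simp only [smul_eq_mul]
  rw [← mul_assoc, pow_finrank_sub_one_mul_rpow hy]

lemma integral_norm_rpow_mul_exp_neg_rpow {s q : ℝ} (hs : 0 ≤ s) (hq : 0 < q)
    (μ : Measure E) [μ.IsAddHaarMeasure] :
    ∫ x : E, ‖x‖ ^ s * exp (-‖x‖ ^ q) ∂μ =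
      Module.finrank ℝ E * μ.real (Metric.ball 0 1) *
        (1 / q * Gamma ((Module.finrank ℝ E + s) / q)) := by
  have hd : (0 : ℝ) < Module.finrank ℝ E := by exact_mod_cast Module.finrank_pos
  rw [integral_fun_norm_addHaar μ (fun r => r ^ s * exp (-r ^ q)),
    setIntegral_congr_fun (g := fun y => y ^ ((Module.finrank ℝ E : ℝ) + s - 1) * exp (-y ^ q))
      measurableSet_Ioi, integral_rpow_mul_exp_neg_rpow hq (by linarith)]
  · simp only [nsmul_eq_mul, smul_eq_mul]
    ring_nf
  · intro y hy
    simp only [smul_eq_mul]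
    rw [← mul_assoc, pow_finrank_sub_one_mul_rpow hy]

lemma integral_exp_neg_norm_rpow_s5 {q : ℝ} (hq : 0 < q) (μ : Measure E) [μ.IsAddHaarMeasure] :
    ∫ x : E, exp (-‖x‖ ^ q) ∂μ =
      μ.real (Metric.ball 0 1) * Gamma (Module.finrank ℝ E / q + 1) := by
  have hd : (0 : ℝ) < Module.finrank ℝ E := by exact_mod_cast Module.finrank_pos
  have h := integral_norm_rpow_mul_exp_neg_rpow le_rfl hq μ
  simp only [rpow_zero, one_mul, add_zero] at h
  rw [h, Gamma_add_one (by positivity)]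
  ring

lemma integral_norm_rpow_self_mul_exp_neg_rpow {q : ℝ} (hq : 0 < q)
    (μ : Measure E) [μ.IsAddHaarMeasure] :
    ∫ x : E, ‖x‖ ^ q * exp (-‖x‖ ^ q) ∂μ =
      Module.finrank ℝ E / q * ∫ x : E, exp (-‖x‖ ^ q) ∂μ := by
  rw [integral_norm_rpow_mul_exp_neg_rpow hq.le hq, integral_exp_neg_norm_rpow_s5 hq, add_div,
    div_self hq.ne']
  ring

end Radial

section Bubble

variable {E : Type*} [NormedAddCommGroup E]

/-- The bubble `x ↦ exp (-‖x‖ ^ q / p)`, regularized at the origin at scale `ε`. -/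
noncomputable def regBubble (p q ε : ℝ) (x : E) : ℝ := exp (-(‖x‖ ^ 2 + ε ^ 2) ^ (q / 2) / p)

lemma sq_norm_rpow_half (q : ℝ) (x : E) : (‖x‖ ^ 2) ^ (q / 2) = ‖x‖ ^ q := by
  rw [← rpow_natCast, ← rpow_mul (norm_nonneg x)]
  congr 1
  push_cast
  ring

lemma regBubble_zero (p q : ℝ) (x : E) : regBubble p q 0 x = exp (-‖x‖ ^ q / p) := by
  simp [regBubble, sq_norm_rpow_half]

lemma regBubble_pos (p q ε : ℝ) (x : E) : 0 < regBubble p q ε x := exp_pos _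

lemma regBubble_le {p q : ℝ} (hp : 0 < p) (hq : 0 < q) (ε : ℝ) (x : E) :
    regBubble p q ε x ≤ exp (-‖x‖ ^ q / p) := by
  rw [← regBubble_zero]
  unfold regBubble
  have : (0 : ℝ) ^ 2 ≤ ε ^ 2 := by simpa using sq_nonneg ε
  gcongr

lemma exp_div_rpow {p : ℝ} (hp : 0 < p) (t : ℝ) : exp (t / p) ^ p = exp t := by
  rw [← exp_mul, div_mul_cancel₀ _ hp.ne']

lemma continuous_regBubble {p q : ℝ} (hq : 0 < q) (x : E) :
    Continuous fun ε : ℝ => regBubble p q ε x := by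
  unfold regBubble
  have : Continuous fun ε : ℝ => (‖x‖ ^ 2 + ε ^ 2) ^ (q / 2) :=
    (by fun_prop : Continuous fun ε : ℝ => ‖x‖ ^ 2 + ε ^ 2).rpow_const
      fun _ => Or.inr (by positivity)
  fun_prop

lemma tendsto_regBubble {p q : ℝ} (hq : 0 < q) (x : E) :
    Tendsto (fun ε : ℝ => regBubble p q ε x) (𝓝[>] 0) (𝓝 (exp (-‖x‖ ^ q / p))) := by
  rw [← regBubble_zero]
  exact (continuous_regBubble hq x).continuousAt.tendsto.mono_left nhdsWithin_le_nhds

variable [InnerProductSpace ℝ E]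

lemma hasFDerivAt_regBubble (p q : ℝ) {ε : ℝ} (hε : 0 < ε) (x : E) :
    HasFDerivAt (regBubble p q ε)
      ((-(q / p) * (regBubble p q ε x * (‖x‖ ^ 2 + ε ^ 2) ^ (q / 2 - 1))) • innerSL ℝ x) x := by
  have h1 : HasFDerivAt (fun y : E => ‖y‖ ^ 2 + ε ^ 2) ((2 : ℝ) • innerSL ℝ x) x := by
    have := (hasStrictFDerivAt_norm_sq (F := E) x).hasFDerivAt.add_const (ε ^ 2)
    refine this.congr_fderiv ?_
    ext y
    simp
  have hne : ‖x‖ ^ 2 + ε ^ 2 ≠ 0 := by positivity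
  have h2 := ((h1.rpow_const (p := q / 2) (Or.inl hne)).fun_neg.mul_const p⁻¹).exp
  have h3 : (regBubble p q ε : E → ℝ) =
      fun y => exp (-(‖y‖ ^ 2 + ε ^ 2) ^ (q / 2) * p⁻¹) := by
    ext y
    rw [regBubble, div_eq_mul_inv]
  rw [h3]
  refine h2.congr_fderiv ?_
  ext y
  simp only [smul_apply, neg_apply, smul_eq_mul, innerSL_apply_apply]
  ring

lemma contDiff_regBubble (p q : ℝ) {ε : ℝ} (hε : 0 < ε) {m : ℕ∞} :
    ContDiff ℝ m (regBubble p q ε : E → ℝ) := by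
  have : ContDiff ℝ m fun x : E => (‖x‖ ^ 2 + ε ^ 2) ^ (q / 2) :=
    ((contDiff_norm_sq ℝ).add contDiff_const).rpow_const_of_ne fun x => by positivity
  exact (this.neg.div_const p).exp

variable [FiniteDimensional ℝ E] (χ : ContDiffBump (0 : E))

/-- The regularized bubble, cut off by the bump function `χ` at scale `1 / ε`. -/
noncomputable def cutBubble (p q ε : ℝ) (x : E) : ℝ :=
  χ (ε • x) * regBubble p q ε x

lemma contDiff_cutBubble (p q : ℝ) {ε : ℝ} (hε : 0 < ε) {m : ℕ∞} :
    ContDiff ℝ m (cutBubble χ p q ε) :=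
  (χ.contDiff.comp (contDiff_const_smul ε)).mul (contDiff_regBubble p q hε)

lemma continuous_abs_cutBubble_rpow {p : ℝ} (hp : 0 < p) (q : ℝ) {ε : ℝ} (hε : 0 < ε) :
    Continuous fun x => |cutBubble χ p q ε x| ^ p :=
  (contDiff_cutBubble χ p q hε (m := 1)).continuous.abs.rpow_const fun _ => Or.inr hp.le

lemma hasCompactSupport_cutBubble (p q : ℝ) {ε : ℝ} (hε : 0 < ε) :
    HasCompactSupport (cutBubble χ p q ε) :=
  (χ.hasCompactSupport.comp_homeomorph (Homeomorph.smulOfNeZero ε hε.ne')).mul_right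

lemma cutBubble_nonneg (p q ε : ℝ) (x : E) : 0 ≤ cutBubble χ p q ε x :=
  mul_nonneg χ.nonneg (regBubble_pos ..).le

lemma cutBubble_le {p q : ℝ} (hp : 0 < p) (hq : 0 < q) (ε : ℝ) (x : E) :
    cutBubble χ p q ε x ≤ exp (-‖x‖ ^ q / p) :=
  (mul_le_of_le_one_left (regBubble_pos ..).le χ.le_one).trans (regBubble_le hp hq ε x)

lemma abs_cutBubble_rpow_le {p q : ℝ} (hp : 0 < p) (hq : 0 < q) (ε : ℝ) (x : E) :
    |cutBubble χ p q ε x| ^ p ≤ exp (-‖x‖ ^ q) := by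
  rw [abs_of_nonneg (cutBubble_nonneg ..), ← exp_div_rpow hp (-‖x‖ ^ q)]
  exact rpow_le_rpow (cutBubble_nonneg ..) (cutBubble_le χ hp hq ε x) hp.le

lemma tendsto_bump_smul (x : E) : Tendsto (fun ε : ℝ => χ (ε • x)) (𝓝[>] 0) (𝓝 1) := by
  have h : Continuous fun ε : ℝ => χ (ε • x) := χ.continuous.comp (by fun_prop)
  have h0 : χ 0 = 1 := χ.one_of_mem_closedBall (Metric.mem_closedBall_self χ.rIn_pos.le)
  simpa [h0] using h.continuousAt.tendsto.mono_left (nhdsWithin_le_nhds (a := (0 : ℝ)))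

lemma tendsto_abs_cutBubble_rpow {p q : ℝ} (hp : 0 < p) (hq : 0 < q) (x : E) :
    Tendsto (fun ε : ℝ => |cutBubble χ p q ε x| ^ p) (𝓝[>] 0) (𝓝 (exp (-‖x‖ ^ q))) := by
  have h := ((tendsto_bump_smul χ x).mul (tendsto_regBubble (p := p) hq x)).abs.rpow_const
    (p := p) (Or.inr hp.le)
  rwa [one_mul, abs_of_pos (exp_pos _), exp_div_rpow hp] at h

lemma fderiv_cutBubble (p q : ℝ) {ε : ℝ} (hε : 0 < ε) (x : E) :
    fderiv ℝ (cutBubble χ p q ε) x =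
      χ (ε • x) • ((-(q / p) * (regBubble p q ε x * (‖x‖ ^ 2 + ε ^ 2) ^ (q / 2 - 1))) •
        innerSL ℝ x) + regBubble p q ε x • ε • fderiv ℝ χ (ε • x) := by
  have h1 : HasFDerivAt (fun y : E => χ (ε • y)) (ε • fderiv ℝ χ (ε • x)) x := by
    have h2 : HasFDerivAt χ (fderiv ℝ χ (ε • x)) (ε • x) :=
      ((χ.contDiff (n := 1)).differentiable (by simp) _).hasFDerivAt
    refine (h2.comp x ((hasFDerivAt_id x).const_smul ε)).congr_fderiv ?_
    ext y
    simp
  exact (h1.mul (hasFDerivAt_regBubble p q hε x)).fderiv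

lemma exists_norm_fderiv_bump_le : ∃ K, 0 ≤ K ∧ ∀ x, ‖fderiv ℝ χ x‖ ≤ K := by
  obtain ⟨K, hK⟩ := (χ.hasCompactSupport.fderiv (𝕜 := ℝ)).exists_bound_of_continuous
    ((χ.contDiff (n := 1)).continuous_fderiv (by simp))
  exact ⟨K, (norm_nonneg _).trans (hK 0), hK⟩

lemma tendsto_norm_fderiv_cutBubble_rpow {p q : ℝ} (hp : 0 < p) (hq : 0 < q) (hpq : (q - 1) * p = q)
    {x : E} (hx : x ≠ 0) :
    Tendsto (fun ε : ℝ => ‖fderiv ℝ (cutBubble χ p q ε) x‖ ^ p) (𝓝[>] 0)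
      (𝓝 ((q / p) ^ p * (‖x‖ ^ q * exp (-‖x‖ ^ q)))) := by
  obtain ⟨K, hK0, hK⟩ := exists_norm_fderiv_bump_le χ
  have hx' : 0 < ‖x‖ := norm_pos_iff.2 hx
  have hid : Tendsto (fun ε : ℝ => ε) (𝓝[>] 0) (𝓝 0) := nhdsWithin_le_nhds
  have hpow : Tendsto (fun ε : ℝ => (‖x‖ ^ 2 + ε ^ 2) ^ (q / 2 - 1)) (𝓝[>] 0)
      (𝓝 (‖x‖ ^ (q - 2))) := by
    have h := (tendsto_const_nhds (x := ‖x‖ ^ 2)).add (hid.pow 2)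
    have h' := h.rpow_const (p := q / 2 - 1) (Or.inl (by positivity))
    convert h' using 2
    rw [← sq_norm_rpow_half]
    congr 1
    · simp
    · ring
  have h1 := (tendsto_bump_smul χ x).smul (((tendsto_const_nhds (x := -(q / p))).mul
    ((tendsto_regBubble (p := p) hq x).mul hpow)).smul_const (innerSL ℝ x))
  have h2 : Tendsto (fun ε : ℝ => regBubble p q ε x • ε • fderiv ℝ χ (ε • x)) (𝓝[>] 0)
      (𝓝 (exp (-‖x‖ ^ q / p) • 0)) := by
    refine (tendsto_regBubble hq x).smul ?_
    refine squeeze_zero_norm' (a := fun ε => |ε| * K) (Eventually.of_forall fun ε => ?_) ?_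
    · rw [norm_smul, Real.norm_eq_abs]
      gcongr
      exact hK _
    · simpa using hid.abs.mul_const K
  have h3 := (h1.add h2).norm.rpow_const (p := p) (Or.inr hp.le)
  refine Tendsto.congr' ?_ (h3.trans (le_of_eq ?_))
  · filter_upwards [self_mem_nhdsWithin] with ε hε
    rw [fderiv_cutBubble χ p q hε]
  · congr 1
    rw [smul_zero, add_zero, one_smul, norm_smul, innerSL_apply_norm, norm_mul, norm_neg,
      Real.norm_of_nonneg (by positivity), Real.norm_of_nonneg (by positivity)]
    have h4 : ‖x‖ ^ (q - 2) * ‖x‖ = ‖x‖ ^ (q - 1) := by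
      rw [← rpow_add_one hx'.ne']
      ring_nf
    rw [mul_assoc, mul_assoc, h4, mul_rpow (by positivity) (by positivity),
      mul_rpow (by positivity) (by positivity), exp_div_rpow hp, ← rpow_mul hx'.le, hpq]
    ring

lemma norm_fderiv_cutBubble_rpow_le {p q : ℝ} (hp : 0 < p) (hq : 1 < q) (hpq : (q - 1) * p = q)
    {K : ℝ} (hK0 : 0 ≤ K) (hK : ∀ x, ‖fderiv ℝ χ x‖ ≤ K) {ε : ℝ} (hε : 0 < ε) (hε1 : ε ≤ 1)
    (x : E) :
    ‖fderiv ℝ (cutBubble χ p q ε) x‖ ^ p ≤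
      (q / p + K) ^ p * 2 ^ (q / 2) * (exp (-‖x‖ ^ q) + ‖x‖ ^ q * exp (-‖x‖ ^ q)) := by
  have hq0 : 0 < q := by linarith
  set G := exp (-‖x‖ ^ q / p) with hG
  set S := (‖x‖ ^ 2 + 1) ^ ((q - 1) / 2) with hS
  have hS1 : 1 ≤ S := one_le_rpow (by nlinarith [sq_nonneg ‖x‖]) (by linarith)
  have hg := regBubble_le hp hq0 ε x
  have hg0 := regBubble_pos p q ε x
  have hε2 : 0 < ‖x‖ ^ 2 + ε ^ 2 := by positivity
  have hrad : (‖x‖ ^ 2 + ε ^ 2) ^ (q / 2 - 1) * ‖x‖ ≤ S := by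
    calc (‖x‖ ^ 2 + ε ^ 2) ^ (q / 2 - 1) * ‖x‖
        ≤ (‖x‖ ^ 2 + ε ^ 2) ^ (q / 2 - 1) * (‖x‖ ^ 2 + ε ^ 2) ^ (1 / 2 : ℝ) := by
          gcongr
          rw [← sqrt_eq_rpow]
          exact le_sqrt_of_sq_le (by nlinarith [sq_nonneg ε])
      _ = (‖x‖ ^ 2 + ε ^ 2) ^ ((q - 1) / 2) := by
          rw [← rpow_add hε2]
          ring_nf
      _ ≤ S := by
          refine rpow_le_rpow hε2.le ?_ (by linarith)
          nlinarith
  have h1 : ‖fderiv ℝ (cutBubble χ p q ε) x‖ ≤ (q / p + K) * S * G := by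
    rw [fderiv_cutBubble χ p q hε]
    calc _ ≤ _ := norm_add_le _ _
      _ = χ (ε • x) * (q / p * (regBubble p q ε x * ((‖x‖ ^ 2 + ε ^ 2) ^ (q / 2 - 1) * ‖x‖))) +
          regBubble p q ε x * (ε * ‖fderiv ℝ χ (ε • x)‖) := by
          rw [norm_smul, norm_smul, norm_smul, norm_smul, innerSL_apply_norm, norm_mul, norm_neg,
            Real.norm_of_nonneg χ.nonneg, Real.norm_of_nonneg hε.le, Real.norm_of_nonneg hg0.le,
            Real.norm_of_nonneg (by positivity), Real.norm_of_nonneg (by positivity)]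
          ring
      _ ≤ 1 * (q / p * (G * S)) + G * (1 * K) := by
          gcongr
          · exact χ.le_one
          · exact hK _
      _ ≤ _ := by
          have : G * K ≤ G * K * S := le_mul_of_one_le_right (by positivity) hS1
          nlinarith
  have h2 : S ^ p ≤ 2 ^ (q / 2) * (1 + ‖x‖ ^ q) := by
    rw [hS, ← rpow_mul (by positivity), show (q - 1) / 2 * p = q / 2 by linarith]
    rcases le_total (‖x‖ ^ 2) 1 with h | h
    · calc (‖x‖ ^ 2 + 1) ^ (q / 2) ≤ 2 ^ (q / 2) := by
            refine rpow_le_rpow (by positivity) (by linarith) (by linarith)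
        _ ≤ _ := le_mul_of_one_le_right (by positivity) (by linarith [rpow_nonneg (norm_nonneg x) q])
    · calc (‖x‖ ^ 2 + 1) ^ (q / 2) ≤ (2 * ‖x‖ ^ 2) ^ (q / 2) := by
            refine rpow_le_rpow (by positivity) (by linarith) (by linarith)
        _ = 2 ^ (q / 2) * ‖x‖ ^ q := by rw [mul_rpow (by norm_num) (by positivity), sq_norm_rpow_half]
        _ ≤ _ := by gcongr; linarith
  calc _ ≤ ((q / p + K) * S * G) ^ p := rpow_le_rpow (norm_nonneg _) h1 hp.le
    _ = (q / p + K) ^ p * S ^ p * exp (-‖x‖ ^ q) := by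
        rw [mul_rpow (by positivity) (by positivity), mul_rpow (by positivity) (by positivity),
          exp_div_rpow hp]
    _ ≤ (q / p + K) ^ p * (2 ^ (q / 2) * (1 + ‖x‖ ^ q)) * exp (-‖x‖ ^ q) := by gcongr
    _ = _ := by ring

lemma abs_mul_log_le_of_le_exp {u t : ℝ} (hu : 0 ≤ u) (ht : 0 ≤ t) (hut : u ≤ exp (-t)) :
    |u * log u| ≤ 2 * exp (-(1 / 2) * t) := by
  rcases hu.eq_or_lt with rfl | hu0
  · simpa using (exp_pos _).le
  have hu1 : u ≤ 1 := hut.trans (exp_le_one_iff.2 (by linarith))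
  have h1 := abs_log_mul_self_rpow_lt u (1 / 2) hu0 hu1 (by norm_num)
  have h2 : u ^ (1 / 2 : ℝ) ≤ exp (-(1 / 2) * t) := by
    calc u ^ (1 / 2 : ℝ) ≤ exp (-t) ^ (1 / 2 : ℝ) := rpow_le_rpow hu hut (by norm_num)
      _ = _ := by
        rw [← exp_mul]
        ring_nf
  have h3 : u = u ^ (1 / 2 : ℝ) * u ^ (1 / 2 : ℝ) := by
    rw [← rpow_add hu0]
    norm_num
  have h4 : u * log u = log u * u ^ (1 / 2 : ℝ) * u ^ (1 / 2 : ℝ) := by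
    nth_rewrite 1 [h3]
    ring
  rw [h4, abs_mul, abs_of_nonneg (rpow_nonneg hu _)]
  gcongr
  exact h1.le.trans (by norm_num)

section Limits

variable [MeasurableSpace E] [BorelSpace E] [Nontrivial E]
  (μ : Measure E) [μ.IsAddHaarMeasure]

lemma tendsto_integral_abs_cutBubble_rpow {p q : ℝ} (hp : 0 < p) (hq : 0 < q) :
    Tendsto (fun ε : ℝ => ∫ x, |cutBubble χ p q ε x| ^ p ∂μ) (𝓝[>] 0)
      (𝓝 (∫ x : E, exp (-‖x‖ ^ q) ∂μ)) := by
  refine tendsto_integral_filter_of_dominated_convergence (fun x => exp (-‖x‖ ^ q)) ?_ ?_ ?_ ?_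
  · filter_upwards [self_mem_nhdsWithin] with ε hε
    exact (continuous_abs_cutBubble_rpow χ hp q hε).aestronglyMeasurable
  · refine Eventually.of_forall fun ε => Eventually.of_forall fun x => ?_
    rw [Real.norm_of_nonneg (by positivity)]
    exact abs_cutBubble_rpow_le χ hp hq ε x
  · simpa using integrable_norm_rpow_mul_exp_neg_mul_rpow le_rfl one_pos hq μ
  · exact Eventually.of_forall fun x => tendsto_abs_cutBubble_rpow χ hp hq x

lemma tendsto_integral_entropy_cutBubble {p q : ℝ} (hp : 0 < p) (hq : 0 < q) :
    Tendsto (fun ε : ℝ => ∫ x, |cutBubble χ p q ε x| ^ p * log (|cutBubble χ p q ε x| ^ p) ∂μ)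
      (𝓝[>] 0) (𝓝 (-∫ x : E, ‖x‖ ^ q * exp (-‖x‖ ^ q) ∂μ)) := by
  rw [← integral_neg]
  refine tendsto_integral_filter_of_dominated_convergence
    (fun x => 2 * exp (-(1 / 2) * ‖x‖ ^ q)) ?_ ?_ ?_ ?_
  · filter_upwards [self_mem_nhdsWithin] with ε hε
    exact (continuous_mul_log.comp
      (continuous_abs_cutBubble_rpow χ hp q hε)).aestronglyMeasurable
  · refine Eventually.of_forall fun ε => Eventually.of_forall fun x => ?_
    exact abs_mul_log_le_of_le_exp (by positivity) (by positivity)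
      (abs_cutBubble_rpow_le χ hp hq ε x)
  · simpa using (integrable_norm_rpow_mul_exp_neg_mul_rpow le_rfl
      (by norm_num : (0 : ℝ) < 1 / 2) hq μ).const_mul 2
  · refine Eventually.of_forall fun x => ?_
    have h := (continuous_mul_log.tendsto _).comp (tendsto_abs_cutBubble_rpow χ hp hq x)
    rw [log_exp] at h
    refine h.trans (le_of_eq ?_)
    ring_nf

lemma tendsto_integral_norm_fderiv_cutBubble_rpow {p q : ℝ} (hp : 0 < p) (hq : 1 < q)
    (hpq : (q - 1) * p = q) :
    Tendsto (fun ε : ℝ => ∫ x, ‖fderiv ℝ (cutBubble χ p q ε) x‖ ^ p ∂μ) (𝓝[>] 0)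
      (𝓝 ((q / p) ^ p * ∫ x : E, ‖x‖ ^ q * exp (-‖x‖ ^ q) ∂μ)) := by
  obtain ⟨K, hK0, hK⟩ := exists_norm_fderiv_bump_le χ
  have hq0 : 0 < q := by linarith
  rw [← integral_const_mul]
  refine tendsto_integral_filter_of_dominated_convergence
    (fun x => (q / p + K) ^ p * 2 ^ (q / 2) *
      (exp (-‖x‖ ^ q) + ‖x‖ ^ q * exp (-‖x‖ ^ q))) ?_ ?_ ?_ ?_
  · filter_upwards [self_mem_nhdsWithin] with ε hε
    exact (((contDiff_cutBubble χ p q hε (m := 1)).continuous_fderiv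
      (by simp)).norm.rpow_const fun _ => Or.inr hp.le).aestronglyMeasurable
  · filter_upwards [Ioc_mem_nhdsGT one_pos] with ε hε
    refine Eventually.of_forall fun x => ?_
    rw [Real.norm_of_nonneg (by positivity)]
    exact norm_fderiv_cutBubble_rpow_le χ hp hq hpq hK0 hK hε.1 hε.2 x
  · have h1 := integrable_norm_rpow_mul_exp_neg_mul_rpow le_rfl one_pos hq0 μ
    have h2 := integrable_norm_rpow_mul_exp_neg_mul_rpow hq0.le one_pos hq0 μ
    simp only [rpow_zero, one_mul, neg_mul] at h1 h2
    exact (h1.add h2).const_mul _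
  · filter_upwards [compl_mem_ae_iff.2 (measure_singleton (μ := μ) (0 : E))] with x hx
    exact tendsto_norm_fderiv_cutBubble_rpow χ hp hq0 hpq hx

end Limits

end Bubble

/-- A logarithmic Sobolev inequality for normalized functions, rescaled to all functions. -/
lemma logSobolev_of_normalized {E : Type*} [NormedAddCommGroup E] [NormedSpace ℝ E]
    [FiniteDimensional ℝ E] [MeasurableSpace E] [BorelSpace E] {μ : Measure E}
    [IsFiniteMeasureOnCompacts μ] {p a C : ℝ} (hp : 0 < p)
    (hineq : ∀ f : E → ℝ, ContDiff ℝ (⊤ : ℕ∞) f → HasCompactSupport f → (∫ x, |f x| ^ p ∂μ = 1) →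
      ∫ x, |f x| ^ p * log (|f x| ^ p) ∂μ ≤ a * log (C * ∫ x, ‖fderiv ℝ f x‖ ^ p ∂μ))
    {f : E → ℝ} (hf : ContDiff ℝ (⊤ : ℕ∞) f) (hfc : HasCompactSupport f)
    (hM : 0 < ∫ x, |f x| ^ p ∂μ) :
    (∫ x, |f x| ^ p * log (|f x| ^ p) ∂μ) / (∫ x, |f x| ^ p ∂μ) - log (∫ x, |f x| ^ p ∂μ) ≤
      a * log (C * ((∫ x, ‖fderiv ℝ f x‖ ^ p ∂μ) / ∫ x, |f x| ^ p ∂μ)) := by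
  set M := ∫ x, |f x| ^ p ∂μ with hMdef
  set c := M ^ (-p⁻¹) with hc
  have hc0 : 0 < c := rpow_pos_of_pos hM _
  have hcp : c ^ p = M⁻¹ := by
    rw [hc, ← rpow_mul hM.le, neg_mul, inv_mul_cancel₀ hp.ne', rpow_neg_one]
  have habs : ∀ x, |c * f x| ^ p = M⁻¹ * |f x| ^ p := fun x => by
    rw [abs_mul, abs_of_pos hc0, mul_rpow hc0.le (abs_nonneg _), hcp]
  have hcont : Continuous fun x => |f x| ^ p :=
    hf.continuous.abs.rpow_const fun _ => Or.inr hp.le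
  have hsupp : HasCompactSupport fun x => |f x| ^ p :=
    hfc.comp_left (g := fun y : ℝ => |y| ^ p) (by simp [hp.ne'])
  have hi1 : Integrable (fun x => |f x| ^ p) μ := hcont.integrable_of_hasCompactSupport hsupp
  have hi2 : Integrable (fun x => |f x| ^ p * log (|f x| ^ p)) μ :=
    (continuous_mul_log.comp hcont).integrable_of_hasCompactSupport hsupp.mul_right
  have key := hineq (fun x => c * f x) (contDiff_const.mul hf) hfc.mul_left (by
    simp_rw [habs]
    rw [integral_const_mul, inv_mul_cancel₀ hM.ne'])
  have hent : ∀ x, |c * f x| ^ p * log (|c * f x| ^ p) =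
      M⁻¹ * (|f x| ^ p * log (|f x| ^ p)) - M⁻¹ * log M * |f x| ^ p := fun x => by
    rw [habs]
    rcases (rpow_nonneg (abs_nonneg (f x)) p).eq_or_lt with h | h
    · simp [← h]
    · rw [log_mul (by positivity) h.ne', log_inv]
      ring
  have hgrad : ∀ x, ‖fderiv ℝ (fun x => c * f x) x‖ ^ p = M⁻¹ * ‖fderiv ℝ f x‖ ^ p := fun x => by
    rw [fderiv_const_mul (hf.differentiable (by simp) x), norm_smul, Real.norm_of_nonneg hc0.le,
      mul_rpow hc0.le (norm_nonneg _), hcp]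
  simp_rw [hent, hgrad] at key
  rw [integral_sub (hi2.const_mul _) (hi1.const_mul _), integral_const_mul, integral_const_mul,
    integral_const_mul, ← hMdef] at key
  convert key using 1
  · field_simp
  · rw [div_eq_inv_mul]

lemma volume_real_ball_eq_ballVol {n : ℕ} (hn : n ≠ 0) :
    (volume : Measure (EuclideanSpace ℝ (Fin n))).real (Metric.ball 0 1) = ballVol n := by
  have : Nonempty (Fin n) := ⟨⟨0, Nat.pos_of_ne_zero hn⟩⟩
  have h : 0 < Gamma ((n : ℝ) / 2 + 1) := Gamma_pos_of_pos (by positivity)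
  rw [measureReal_def, EuclideanSpace.volume_ball, ballVol, Fintype.card_fin, ENNReal.ofReal_one,
    one_pow, one_mul, ENNReal.toReal_ofReal (by positivity), sqrt_eq_rpow, ← rpow_natCast,
    ← rpow_mul pi_pos.le]
  ring_nf

/-- Sharpness of the constant in the `L^p`-logarithmic Sobolev inequality in `ℝ^n`. -/
theorem sharp_Lp_log_sobolev_euclidean_sharpness (n : ℕ) (hn : 2 ≤ n) (p : ℝ) (hp : 1 < p)
    (C : ℝ) (hC : 0 < C)
    (hineq : ∀ f : EuclideanSpace ℝ (Fin n) → ℝ, ContDiff ℝ (⊤ : ℕ∞) f → HasCompactSupport f →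
      (∫ x : EuclideanSpace ℝ (Fin n), |f x| ^ p = 1) →
      ∫ x : EuclideanSpace ℝ (Fin n), |f x| ^ p * Real.log (|f x| ^ p) ≤
        ((n : ℝ) / p) * Real.log
          (C * ∫ x : EuclideanSpace ℝ (Fin n), ‖fderiv ℝ f x‖ ^ p)) :
    Lconst n p ≤ C := by
  have hp0 : 0 < p := by linarith
  have hn0 : (0 : ℝ) < n := by positivity
  have : Nonempty (Fin n) := ⟨⟨0, by omega⟩⟩
  set q := p / (p - 1) with hqdef
  have hp1 : 0 < p - 1 := by linarith
  have hq1 : 1 < q := (one_lt_div hp1).2 (by linarith)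
  have hq0 : 0 < q := by linarith
  have hpq : (q - 1) * p = q := by
    rw [hqdef]
    field_simp
    ring
  let χ : ContDiffBump (0 : EuclideanSpace ℝ (Fin n)) := ⟨1, 2, one_pos, one_lt_two⟩
  have hM := tendsto_integral_abs_cutBubble_rpow χ volume hp0 hq0
  have hH := tendsto_integral_entropy_cutBubble χ volume hp0 hq0
  have hG := tendsto_integral_norm_fderiv_cutBubble_rpow χ volume hp0 hq1 hpq
  rw [integral_norm_rpow_self_mul_exp_neg_rpow hq0] at hH hG
  rw [integral_exp_neg_norm_rpow_s5 hq0, finrank_euclideanSpace_fin,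
    volume_real_ball_eq_ballVol (by omega)] at hM hH hG
  unfold Lconst
  rw [← hqdef]
  have hball : 0 < ballVol n :=
    div_pos (by positivity) (Gamma_pos_of_pos (by positivity))
  have hMpos : 0 < ballVol n * Gamma (n / q + 1) :=
    mul_pos hball (Gamma_pos_of_pos (by positivity))
  set M := ballVol n * Gamma (n / q + 1)
  have hlim := le_of_tendsto_of_tendsto ((hH.div hM hMpos.ne').sub (hM.log hMpos.ne'))
    ((((hG.div hM hMpos.ne').const_mul C).log (by positivity)).const_mul ((n : ℝ) / p)) (by
      filter_upwards [self_mem_nhdsWithin, hM.eventually (lt_mem_nhds hMpos)] with ε hε hMε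
      exact logSobolev_of_normalized hp0 hineq (contDiff_cutBubble χ p q hε)
        (hasCompactSupport_cutBubble χ p q hε) hMε)
  have hqp : q / p = (p - 1)⁻¹ := by
    rw [hqdef]
    field_simp
  have hgrad : C * ((q / p) ^ p * (n / q * M) / M) = C * (n / p * (p - 1) ^ (1 - p)) := by
    rw [hqp, inv_rpow hp1.le, ← rpow_neg hp1.le, sub_eq_add_neg 1 p, rpow_add hp1, rpow_one, hqdef]
    field_simp
  have hent : -(n / q * M) / M = -(n / q) := by field_simp
  rw [hgrad, hent, log_mul hC.ne' (by positivity),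
    log_mul (x := n / p) (by positivity) (by positivity), log_div hn0.ne' hp0.ne',
    log_rpow hp1] at hlim
  rw [← log_le_log_iff (by positivity) hC, log_mul (by positivity) (by positivity),
    log_mul (by positivity) (by positivity), log_rpow hMpos, log_rpow (by positivity),
    log_div (by positivity) (by positivity), log_div (by positivity) (by positivity), log_exp]
  have hfin := mul_le_mul_of_nonneg_left hlim (by positivity : 0 ≤ p / n)
  have e1 : p / n * (-(n / q) - log M) = -(p - 1) - p / n * log M := by
    rw [hqdef]
    field_simp
  have e2 : ∀ t : ℝ, p / n * (n / p * t) = t := fun t => by field_simp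
  rw [e1, e2] at hfin
  linarith
end
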